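/- Let ρ be a quantum state on a finite-dimensional complex Hilbert space H, let {S_n}_{n≥1} satisfy Assumption 1, and suppose S_1 contains a state whose support contains supp(ρ). Then for any r > 0 the strong converse exponent satisfies: lim_{n→∞} (1/n) H*_{nr}(ρ^{⊗n}‖S_n) = sup_{n≥1} sup_{α>1} sup_{σ⁽ⁿ⁾ ∈ S_n} ((α−1)/α)(r − (1/n) D̃_α(ρ^{⊗n}‖σ⁽ⁿ⁾)) ≤ sc_r(ρ‖{S_n}) ≤ inf_{n≥1} inf_{M_n} sup_{α>1} sup_{σ⁽ⁿ⁾ ∈ S_n} ((α−1)/α)(r − (1/n) D_α(M_n(ρ^{⊗n}) ‖ M_n(σ⁽ⁿ⁾))), where the infimum is over all measurements M_n on H^{⊗n} with finitely many POVM elements, M_n(X) denotes the tuple of outcome values (Tr[M X])_{M ∈ M_n}, and D_α of two such tuples is the classical Rényi divergence (α−1)^{−1} log Σ_i p_i^α q_i^{1−α}. -/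

import Mathlib

open scoped BigOperators ComplexOrder Classical
open MeasureTheory Filter Set

noncomputable section

namespace QHT

variable {ι : Type*} [Fintype ι] [DecidableEq ι]

/-- Generalized matrix power `A ^ w` (complex exponent `w`) of a Hermitian matrix,
via functional calculus on the support: the eigenvalue `0` is mapped to `0`. -/
def mpow (A : Matrix ι ι ℂ) (w : ℂ) : Matrix ι ι ℂ :=
  if hA : A.IsHermitian then
    (hA.eigenvectorUnitary : Matrix ι ι ℂ) *
      Matrix.diagonal (fun i => if hA.eigenvalues i = 0 then 0 else (hA.eigenvalues i : ℂ) ^ w) *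
      star (hA.eigenvectorUnitary : Matrix ι ι ℂ)
  else 0

/-- Matrix logarithm of a Hermitian matrix, taken on its support
(`Real.log 0 = 0`, so the kernel is mapped to `0`). -/
def mlog (A : Matrix ι ι ℂ) : Matrix ι ι ℂ :=
  if hA : A.IsHermitian then
    (hA.eigenvectorUnitary : Matrix ι ι ℂ) *
      Matrix.diagonal (fun i => (Real.log (hA.eigenvalues i) : ℂ)) *
      star (hA.eigenvectorUnitary : Matrix ι ι ℂ)
  else 0

/-- The support of a matrix, i.e. its range as a linear map. -/
def msupp (A : Matrix ι ι ℂ) : Submodule ℂ (ι → ℂ) := LinearMap.range A.mulVecLin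

/-- A quantum state: a positive semidefinite matrix of trace one. -/
def IsState (A : Matrix ι ι ℂ) : Prop := A.PosSemidef ∧ A.trace = 1

/-- Real part of the trace. -/
def rtr (A : Matrix ι ι ℂ) : ℝ := A.trace.re

/-- The Umegaki relative entropy `D(ρ‖σ)`, with value `+∞` when `supp ρ ⊄ supp σ`. -/
def relEnt (ρ σ : Matrix ι ι ℂ) : EReal :=
  if msupp ρ ≤ msupp σ then ((rtr (ρ * (mlog ρ - mlog σ)) : ℝ) : EReal) else ⊤

/-- The polar of a set of matrices (intersected with the PSD cone). -/
def polar (S : Set (Matrix ι ι ℂ)) : Set (Matrix ι ι ℂ) :=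
  {X | X.PosSemidef ∧ ∀ Y ∈ S, rtr (X * Y) ≤ 1}

/-- Entrywise Bochner integral of a matrix-valued function over `ℝ`. -/
def mInt (f : ℝ → Matrix ι ι ℂ) : Matrix ι ι ℂ :=
  Matrix.of fun i j => ∫ t : ℝ, f t i j

/-- Entrywise Bochner integral of a matrix-valued function over a set `s ⊆ ℝ`. -/
def mIntOn (f : ℝ → Matrix ι ι ℂ) (s : Set ℝ) : Matrix ι ι ℂ :=
  Matrix.of fun i j => ∫ t in s, f t i j

/-- `sinc` function. -/
def sinc (s : ℝ) : ℝ := if s = 0 then 1 else Real.sin s / s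

/-- The probability density `β_θ` from the paper (`β₀` is the `θ → 0` limit). -/
def betaDist (θ t : ℝ) : ℝ :=
  if θ = 0 then Real.pi / (2 * (Real.cosh (Real.pi * t) + 1))
  else Real.sin (θ * Real.pi) / (2 * θ * (Real.cosh (Real.pi * t) + Real.cos (θ * Real.pi)))

/-- `Q_{α,z}(ρ‖σ) = Tr[(ρ^{α/2z} σ^{(1-α)/z} ρ^{α/2z})^z]`. -/
def Qaz (α z : ℝ) (ρ σ : Matrix ι ι ℂ) : ℝ :=
  rtr (mpow (mpow ρ ((α / (2 * z) : ℝ) : ℂ) * mpow σ (((1 - α) / z : ℝ) : ℂ) *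
      mpow ρ ((α / (2 * z) : ℝ) : ℂ)) ((z : ℝ) : ℂ))

/-- The `α`-`z` Rényi relative entropy. -/
def Daz (α z : ℝ) (ρ σ : Matrix ι ι ℂ) : EReal :=
  if (α < 1 ∧ (ρ * σ).trace ≠ 0) ∨ msupp ρ ≤ msupp σ then
    (((α - 1)⁻¹ * Real.log (Qaz α z ρ σ) : ℝ) : EReal)
  else ⊤

/-- `Q_α(ρ‖σ) = Tr[ρ^α σ^{1-α}]` (Petz). -/
def Qpetz (α : ℝ) (ρ σ : Matrix ι ι ℂ) : ℝ :=
  rtr (mpow ρ ((α : ℝ) : ℂ) * mpow σ (((1 - α) : ℝ) : ℂ))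

/-- The Petz Rényi divergence. -/
def Dpetz (α : ℝ) (ρ σ : Matrix ι ι ℂ) : EReal :=
  if (α < 1 ∧ (ρ * σ).trace ≠ 0) ∨ msupp ρ ≤ msupp σ then
    (((α - 1)⁻¹ * Real.log (Qpetz α ρ σ) : ℝ) : EReal)
  else ⊤

/-- `Q̃_α(ρ‖σ) = Tr[(σ^{(1-α)/2α} ρ σ^{(1-α)/2α})^α]` (sandwiched). -/
def Qsand (α : ℝ) (ρ σ : Matrix ι ι ℂ) : ℝ :=
  rtr (mpow (mpow σ (((1 - α) / (2 * α) : ℝ) : ℂ) * ρ * mpow σ (((1 - α) / (2 * α) : ℝ) : ℂ))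
    ((α : ℝ) : ℂ))

/-- The sandwiched Rényi divergence. -/
def Dsand (α : ℝ) (ρ σ : Matrix ι ι ℂ) : EReal :=
  if (α < 1 ∧ (ρ * σ).trace ≠ 0) ∨ msupp ρ ≤ msupp σ then
    (((α - 1)⁻¹ * Real.log (Qsand α ρ σ) : ℝ) : EReal)
  else ⊤

/-- `D̃_∞(ρ‖σ)`: the limit of `D̃_α(ρ‖σ)` as `α → +∞` (encoded as a `limsup`; the limit
exists by monotonicity in `α`). -/
def DsandInf (ρ σ : Matrix ι ι ℂ) : EReal :=
  Filter.limsup (fun α : ℝ => Dsand α ρ σ) Filter.atTop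

/-- `χ_{α,z}(ρ,σ) = ρ^{α/2z} (ρ^{α/2z} σ^{(1-α)/z} ρ^{α/2z})^{z-1} ρ^{α/2z}`. -/
def chi (α z : ℝ) (ρ σ : Matrix ι ι ℂ) : Matrix ι ι ℂ :=
  mpow ρ ((α / (2 * z) : ℝ) : ℂ) *
    mpow (mpow ρ ((α / (2 * z) : ℝ) : ℂ) * mpow σ (((1 - α) / z : ℝ) : ℂ) *
      mpow ρ ((α / (2 * z) : ℝ) : ℂ)) (((z - 1 : ℝ)) : ℂ) *
    mpow ρ ((α / (2 * z) : ℝ) : ℂ)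

/-- The data-processing region `𝒟` for `α`-`z` Rényi relative entropies. -/
def Dregion : Set (ℝ × ℝ) :=
  {p | (0 < p.1 ∧ p.1 < 1 ∧ max p.1 (1 - p.1) ≤ p.2) ∨
       (1 < p.1 ∧ max (p.1 / 2) (p.1 - 1) ≤ p.2 ∧ p.2 ≤ p.1) ∨
       (p.1 = 1 ∧ 0 < p.2)}

end QHT

namespace QHT

variable {ι : Type*} [Fintype ι] [DecidableEq ι]

/-! ### Tensor products and many copies -/

/-- Tensor product of a `d₁`- and a `d₂`-dimensional operator, as a `d₁d₂`-dimensional one. -/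
def dtens {a b : ℕ} (A : Matrix (Fin a) (Fin a) ℂ) (B : Matrix (Fin b) (Fin b) ℂ) :
    Matrix (Fin (a * b)) (Fin (a * b)) ℂ :=
  Matrix.of fun x y =>
    A (finProdFinEquiv.symm x).1 (finProdFinEquiv.symm y).1 *
      B (finProdFinEquiv.symm x).2 (finProdFinEquiv.symm y).2

/-- `ρ^{⊗n}` of a `d`-dimensional operator, as a `d^n`-dimensional operator. -/
def dpow {d : ℕ} (ρ : Matrix (Fin d) (Fin d) ℂ) (n : ℕ) :
    Matrix (Fin (d ^ n)) (Fin (d ^ n)) ℂ :=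
  Matrix.of fun x y => ∏ i, ρ (finFunctionFinEquiv.symm x i) (finFunctionFinEquiv.symm y i)

/-- The action of a permutation of the `k` tensor factors on an operator on `(ℂ^d)^{⊗k}`. -/
def permMat (d k : ℕ) (π : Equiv.Perm (Fin k)) (A : Matrix (Fin (d ^ k)) (Fin (d ^ k)) ℂ) :
    Matrix (Fin (d ^ k)) (Fin (d ^ k)) ℂ :=
  Matrix.of fun x y =>
    A (finFunctionFinEquiv ((finFunctionFinEquiv.symm x) ∘ π))
      (finFunctionFinEquiv ((finFunctionFinEquiv.symm y) ∘ π))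

/-- `ρ^{⊗n}` of a `d`-dimensional operator, as an operator on `H^{⊗n}` with `H = ℂ^d`,
indexed by tuples. -/
def tpow {d : ℕ} (ρ : Matrix (Fin d) (Fin d) ℂ) (n : ℕ) :
    Matrix (Fin n → Fin d) (Fin n → Fin d) ℂ :=
  Matrix.of fun x y => ∏ i, ρ (x i) (y i)

/-- Tensor product of an operator on `H^{⊗m}` and an operator on `H^{⊗n}`, as an
operator on `H^{⊗(m+n)}`. -/
def tensOp {d m n : ℕ} (A : Matrix (Fin m → Fin d) (Fin m → Fin d) ℂ)
    (B : Matrix (Fin n → Fin d) (Fin n → Fin d) ℂ) :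
    Matrix (Fin (m + n) → Fin d) (Fin (m + n) → Fin d) ℂ :=
  Matrix.of fun x y =>
    A (fun i => x (Fin.castAdd n i)) (fun i => y (Fin.castAdd n i)) *
      B (fun j => x (Fin.natAdd m j)) (fun j => y (Fin.natAdd m j))

/-- Permutation action on operators on `H^{⊗k}`. -/
def permOp {d k : ℕ} (π : Equiv.Perm (Fin k))
    (A : Matrix (Fin k → Fin d) (Fin k → Fin d) ℂ) :
    Matrix (Fin k → Fin d) (Fin k → Fin d) ℂ :=
  Matrix.of fun x y => A (x ∘ π) (y ∘ π)

/-! ### Hypothesis testing -/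

/-- A test: an operator `T` with `0 ≤ T ≤ I`. -/
def IsTest (T : Matrix ι ι ℂ) : Prop := T.PosSemidef ∧ (1 - T).PosSemidef

/-- Type I error `α_n(ρ|T) = Tr[(I - T) ρ^{⊗n}]`. -/
def typeI {d : ℕ} (ρ : Matrix (Fin d) (Fin d) ℂ) (n : ℕ)
    (T : Matrix (Fin n → Fin d) (Fin n → Fin d) ℂ) : ℝ :=
  rtr ((1 - T) * tpow ρ n)

/-- Type II error `β_n(S|T) = sup_{σ ∈ S} Tr[σ T]`. -/
def typeII {d n : ℕ} (S : Set (Matrix (Fin n → Fin d) (Fin n → Fin d) ℂ))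
    (T : Matrix (Fin n → Fin d) (Fin n → Fin d) ℂ) : ℝ :=
  sSup ((fun σ => rtr (σ * T)) '' S)

/-- `- log x`, valued in `EReal`, with `- log x = +∞` for `x ≤ 0`. -/
def negLog (x : ℝ) : EReal := if x ≤ 0 then ⊤ else ((- Real.log x : ℝ) : EReal)

/-- The exponential rate `-(1/n) log x`. -/
def rate (n : ℕ) (x : ℝ) : EReal := (((n : ℝ)⁻¹ : ℝ) : EReal) * negLog x

/-- The Stein exponent `s(ρ‖{S_n})`. -/
def steinExp {d : ℕ} (ρ : Matrix (Fin d) (Fin d) ℂ)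
    (S : (n : ℕ) → Set (Matrix (Fin n → Fin d) (Fin n → Fin d) ℂ)) : EReal :=
  sSup ((fun r : ℝ => (r : EReal)) ''
    {r : ℝ | 0 ≤ r ∧ ∃ T : (n : ℕ) → Matrix (Fin n → Fin d) (Fin n → Fin d) ℂ,
      (∀ n, IsTest (T n)) ∧
      (r : EReal) ≤ Filter.liminf (fun n => rate n (typeII (S n) (T n))) Filter.atTop ∧
      Filter.Tendsto (fun n => typeI ρ n (T n)) Filter.atTop (nhds 0)})

/-- The Chernoff exponent `c(ρ‖{S_n})`. -/
def chernoffExp {d : ℕ} (ρ : Matrix (Fin d) (Fin d) ℂ)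
    (S : (n : ℕ) → Set (Matrix (Fin n → Fin d) (Fin n → Fin d) ℂ)) : EReal :=
  Filter.liminf (fun n =>
    rate n (sInf ((fun T => typeI ρ n T + typeII (S n) T) '' {T | IsTest T}))) Filter.atTop

/-- The Hoeffding (direct) exponent `d_r(ρ‖{S_n})`. -/
def hoeffdingExp {d : ℕ} (r : ℝ) (ρ : Matrix (Fin d) (Fin d) ℂ)
    (S : (n : ℕ) → Set (Matrix (Fin n → Fin d) (Fin n → Fin d) ℂ)) : EReal :=
  ⨆ T : {T : (n : ℕ) → Matrix (Fin n → Fin d) (Fin n → Fin d) ℂ //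
      (∀ n, IsTest (T n)) ∧
      (r : EReal) ≤ Filter.liminf (fun n => rate n (typeII (S n) (T n))) Filter.atTop},
    Filter.liminf (fun n => rate n (typeI ρ n (T.1 n))) Filter.atTop

/-- The strong converse exponent `sc_r(ρ‖{S_n})`. -/
def scExp {d : ℕ} (r : ℝ) (ρ : Matrix (Fin d) (Fin d) ℂ)
    (S : (n : ℕ) → Set (Matrix (Fin n → Fin d) (Fin n → Fin d) ℂ)) : EReal :=
  ⨅ T : {T : (n : ℕ) → Matrix (Fin n → Fin d) (Fin n → Fin d) ℂ //
      (∀ n, IsTest (T n)) ∧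
      (r : EReal) ≤ Filter.liminf (fun n => rate n (typeII (S n) (T n))) Filter.atTop},
    Filter.limsup (fun n => rate n (1 - typeI ρ n (T.1 n))) Filter.atTop

/-- Assumption 1 of the paper for a family `{S_n}_{n ≥ 1}` of sets of operators
on `H^{⊗n}`, `H = ℂ^d`: each `S_n` is a convex compact set of positive semidefinite
operators, closed under tensor products, and with polar sets closed under tensor
products. -/
structure Assumption1 {d : ℕ}
    (S : (n : ℕ) → Set (Matrix (Fin n → Fin d) (Fin n → Fin d) ℂ)) : Prop where
  psd : ∀ n, 1 ≤ n → ∀ X ∈ S n, X.PosSemidef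
  convex : ∀ n, 1 ≤ n → Convex ℝ (S n)
  compact : ∀ n, 1 ≤ n → IsCompact (S n)
  tens : ∀ m n, 1 ≤ m → 1 ≤ n → ∀ A ∈ S m, ∀ B ∈ S n, tensOp A B ∈ S (m + n)
  polarTens : ∀ m n, 1 ≤ m → 1 ≤ n →
    ∀ A ∈ polar (S m), ∀ B ∈ polar (S n), tensOp A B ∈ polar (S (m + n))

/-- Assumption 1′ of the paper for a dimension-indexed family `{S_d}_{d ≥ 1}`. -/
structure Assumption1' (S : (d : ℕ) → Set (Matrix (Fin d) (Fin d) ℂ)) : Prop where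
  psd : ∀ d, 1 ≤ d → ∀ X ∈ S d, X.PosSemidef
  convex : ∀ d, 1 ≤ d → Convex ℝ (S d)
  compact : ∀ d, 1 ≤ d → IsCompact (S d)
  tens : ∀ d₁ d₂, 1 ≤ d₁ → 1 ≤ d₂ → ∀ A ∈ S d₁, ∀ B ∈ S d₂, dtens A B ∈ S (d₁ * d₂)
  polarTens : ∀ d₁ d₂, 1 ≤ d₁ → 1 ≤ d₂ →
    ∀ A ∈ polar (S d₁), ∀ B ∈ polar (S d₂), dtens A B ∈ polar (S (d₁ * d₂))

end QHT

namespace QHT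

variable {ι : Type*} [Fintype ι] [DecidableEq ι]

/-- The Hoeffding anti-divergence
`H*_r(ρ‖σ) = max_{α ∈ [1,∞]} ((α-1)/α)(r - D̃_α(ρ‖σ))`, where the `α = +∞` term is
`r - D̃_∞(ρ‖σ)`. -/
noncomputable def Hstar (r : EReal) (ρ σ : Matrix ι ι ℂ) : EReal :=
  max (⨆ α ∈ Set.Ici (1 : ℝ), (((α - 1) / α : ℝ) : EReal) * (r - Dsand α ρ σ))
    (r - DsandInf ρ σ)

/-- A POVM with finitely many elements. -/
def IsPOVM {k : ℕ} (M : Fin k → Matrix ι ι ℂ) : Prop :=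
  (∀ i, (M i).PosSemidef) ∧ ∑ i, M i = 1

/-- The classical Rényi divergence of two tuples of outcome values,
`(α-1)⁻¹ log Σ_i p_i^α q_i^{1-α}`. -/
noncomputable def classRenyi {k : ℕ} (α : ℝ) (p q : Fin k → ℝ) : ℝ :=
  (α - 1)⁻¹ * Real.log (∑ i, p i ^ α * q i ^ (1 - α))

set_option linter.unusedSectionVars false

/-- Real power with the convention that `0` is mapped to `0`, for every exponent. -/
def rp (t x : ℝ) : ℝ := if x = 0 then 0 else x ^ t

lemma rp_nonneg (t : ℝ) {x : ℝ} (hx : 0 ≤ x) : 0 ≤ rp t x := by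
  unfold rp; split_ifs
  · exact le_rfl
  · exact Real.rpow_nonneg hx t

lemma rp_eq_rpow {t : ℝ} (ht : t ≠ 0) (x : ℝ) : rp t x = x ^ t := by
  unfold rp; split_ifs with h
  · rw [h, Real.zero_rpow ht]
  · rfl

lemma rp_mul_rp (s t : ℝ) {x : ℝ} (hx : 0 ≤ x) : rp s x * rp t x = rp (s + t) x := by
  unfold rp; split_ifs with h
  · simp
  · rw [Real.rpow_add (lt_of_le_of_ne hx (Ne.symm h))]

lemma rp_mul_base (t : ℝ) {x y : ℝ} (hx : 0 ≤ x) (hy : 0 ≤ y) :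
    rp t (x * y) = rp t x * rp t y := by
  unfold rp
  by_cases h : x = 0
  · simp [h]
  by_cases h' : y = 0
  · simp [h']
  simp [h, h', Real.mul_rpow hx hy]

/-- The matrix `U diag(a) U*`. -/
def conjDiag (U : Matrix ι ι ℂ) (a : ι → ℝ) : Matrix ι ι ℂ :=
  U * Matrix.diagonal (fun i => (a i : ℂ)) * star U

lemma conjDiag_isHermitian (U : Matrix ι ι ℂ) (a : ι → ℝ) : (conjDiag U a).IsHermitian := by
  unfold conjDiag
  rw [Matrix.star_eq_conjTranspose]
  apply Matrix.isHermitian_mul_mul_conjTranspose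
  exact Matrix.isHermitian_diagonal_of_self_adjoint _ (by ext i; simp)

lemma conjDiag_posSemidef (U : Matrix ι ι ℂ) {a : ι → ℝ} (ha : ∀ i, 0 ≤ a i) :
    (conjDiag U a).PosSemidef := by
  unfold conjDiag
  rw [Matrix.star_eq_conjTranspose]
  apply Matrix.PosSemidef.mul_mul_conjTranspose_same
  exact Matrix.PosSemidef.diagonal fun i => by simpa using ha i

lemma conjDiag_mul {U : Matrix ι ι ℂ} (hU : star U * U = 1) (a b : ι → ℝ) :
    conjDiag U a * conjDiag U b = conjDiag U (fun i => a i * b i) := by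
  unfold conjDiag
  calc _ = U * Matrix.diagonal (fun i => (a i : ℂ)) * (star U * U) *
        Matrix.diagonal (fun i => (b i : ℂ)) * star U := by simp only [Matrix.mul_assoc]
    _ = _ := by
      rw [hU, Matrix.mul_one, Matrix.mul_assoc U, Matrix.diagonal_mul_diagonal]
      simp

lemma rtr_conjDiag {U : Matrix ι ι ℂ} (hU : star U * U = 1) (a : ι → ℝ) :
    rtr (conjDiag U a) = ∑ i, a i := by
  unfold rtr conjDiag
  rw [Matrix.trace_mul_comm, ← Matrix.mul_assoc, hU, Matrix.one_mul, Matrix.trace_diagonal]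
  simp

lemma mpow_conjDiag {U : Matrix ι ι ℂ} (hU : star U * U = 1) (a : ι → ℝ) (w : ℂ) :
    mpow (conjDiag U a) w =
      U * Matrix.diagonal (fun i => if a i = 0 then 0 else (a i : ℂ) ^ w) * star U := by
  have hH := conjDiag_isHermitian U a
  have hU' : U * star U = 1 := mul_eq_one_comm.mp hU
  unfold mpow
  rw [dif_pos hH]
  set V : Matrix ι ι ℂ := (hH.eigenvectorUnitary : Matrix ι ι ℂ) with hV
  have hV1 : star V * V = 1 := Unitary.coe_star_mul_self _
  have hV2 : V * star V = 1 := Unitary.coe_mul_star_self _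
  have hsp : conjDiag U a = V * Matrix.diagonal (fun i => (hH.eigenvalues i : ℂ)) * star V :=
    hH.spectral_theorem
  set l := hH.eigenvalues with hl
  set W := star V * U with hW
  have key : Matrix.diagonal (fun i => (l i : ℂ)) * W =
      W * Matrix.diagonal (fun i => (a i : ℂ)) := by
    calc _ = star V * (V * Matrix.diagonal (fun i => (l i : ℂ)) * star V) * U := by
          rw [hW, ← Matrix.mul_assoc, ← Matrix.mul_assoc, ← Matrix.mul_assoc, hV1, Matrix.one_mul]
      _ = star V * (U * Matrix.diagonal (fun i => (a i : ℂ)) * star U) * U := by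
          rw [← hsp]; rfl
      _ = _ := by
          rw [hW, Matrix.mul_assoc, Matrix.mul_assoc, hU, Matrix.mul_one, Matrix.mul_assoc]
  have key2 : Matrix.diagonal (fun i => if l i = 0 then 0 else (l i : ℂ) ^ w) * W =
      W * Matrix.diagonal (fun i => if a i = 0 then 0 else (a i : ℂ) ^ w) := by
    ext i j
    have h := congrFun (congrFun key i) j
    rw [Matrix.diagonal_mul, Matrix.mul_diagonal] at h ⊢
    by_cases hw : W i j = 0
    · simp [hw]
    · have : (l i : ℂ) = a j := by
        rw [mul_comm] at h
        exact mul_left_cancel₀ hw h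
      have h' : l i = a j := by exact_mod_cast this
      rw [h', mul_comm]
  calc _ = V * (Matrix.diagonal (fun i => if l i = 0 then 0 else (l i : ℂ) ^ w) * W) * star U := by
        rw [hW]
        simp only [Matrix.mul_assoc]
        rw [hU', Matrix.mul_one]
    _ = _ := by
        rw [key2, hW]
        simp only [← Matrix.mul_assoc]
        rw [hV2, Matrix.one_mul]

lemma mpow_conjDiag_real {U : Matrix ι ι ℂ} (hU : star U * U = 1) {a : ι → ℝ}
    (ha : ∀ i, 0 ≤ a i) (t : ℝ) :
    mpow (conjDiag U a) (t : ℂ) = conjDiag U (fun i => rp t (a i)) := by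
  rw [mpow_conjDiag hU]
  unfold conjDiag
  congr 3
  ext i
  change _ = ((rp t (a i) : ℝ) : ℂ)
  unfold rp
  by_cases h : a i = 0
  · simp [h]
  · simp [h, Complex.ofReal_cpow (ha i)]

lemma exists_conjDiag {A : Matrix ι ι ℂ} (hA : A.PosSemidef) :
    ∃ U : Matrix ι ι ℂ, ∃ a : ι → ℝ, star U * U = 1 ∧ (∀ i, 0 ≤ a i) ∧ A = conjDiag U a :=
  ⟨hA.1.eigenvectorUnitary, hA.1.eigenvalues, Unitary.coe_star_mul_self _,
    hA.eigenvalues_nonneg, hA.1.spectral_theorem⟩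

lemma mpow_posSemidef {A : Matrix ι ι ℂ} (hA : A.PosSemidef) (t : ℝ) :
    (mpow A (t : ℂ)).PosSemidef := by
  obtain ⟨U, a, hU, ha, rfl⟩ := exists_conjDiag hA
  rw [mpow_conjDiag_real hU ha]
  exact conjDiag_posSemidef U fun i => rp_nonneg t (ha i)

lemma mpow_mul_mpow {A : Matrix ι ι ℂ} (hA : A.PosSemidef) (s t : ℝ) :
    mpow A (s : ℂ) * mpow A (t : ℂ) = mpow A ((s + t : ℝ) : ℂ) := by
  obtain ⟨U, a, hU, ha, rfl⟩ := exists_conjDiag hA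
  rw [mpow_conjDiag_real hU ha, mpow_conjDiag_real hU ha, mpow_conjDiag_real hU ha,
    conjDiag_mul hU]
  simp only [rp_mul_rp _ _ (ha _)]

lemma mpow_one {A : Matrix ι ι ℂ} (hA : A.PosSemidef) : mpow A ((1 : ℝ) : ℂ) = A := by
  obtain ⟨U, a, hU, ha, rfl⟩ := exists_conjDiag hA
  rw [mpow_conjDiag_real hU ha]
  simp only [rp_eq_rpow one_ne_zero, Real.rpow_one]

lemma mpow_zero_mul_self {A : Matrix ι ι ℂ} (hA : A.PosSemidef) :
    mpow A ((0 : ℝ) : ℂ) * A = A := by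
  calc _ = mpow A ((0 : ℝ) : ℂ) * mpow A ((1 : ℝ) : ℂ) := by rw [mpow_one hA]
    _ = A := by rw [mpow_mul_mpow hA, zero_add, mpow_one hA]

lemma rtr_mpow_eq_roots {A : Matrix ι ι ℂ} (hA : A.PosSemidef) (t : ℝ) :
    rtr (mpow A (t : ℂ)) = (A.charpoly.roots.map (fun z : ℂ => rp t z.re)).sum := by
  have h := hA.1.spectral_theorem
  have h2 : A = conjDiag (hA.1.eigenvectorUnitary : Matrix ι ι ℂ) hA.1.eigenvalues := h
  rw [hA.1.roots_charpoly_eq_eigenvalues]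
  conv_lhs => rw [h2]
  rw [mpow_conjDiag_real (Unitary.coe_star_mul_self _) hA.eigenvalues_nonneg,
    rtr_conjDiag (Unitary.coe_star_mul_self _)]
  rw [Multiset.map_map]
  rfl

lemma rtr_mpow_conjTranspose_mul_comm (C : Matrix ι ι ℂ) (t : ℝ) :
    rtr (mpow (C.conjTranspose * C) (t : ℂ)) = rtr (mpow (C * C.conjTranspose) (t : ℂ)) := by
  rw [rtr_mpow_eq_roots (Matrix.posSemidef_conjTranspose_mul_self C),
    rtr_mpow_eq_roots (Matrix.posSemidef_self_mul_conjTranspose C), Matrix.charpoly_mul_comm]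

lemma msupp_le_iff {A B : Matrix ι ι ℂ} : msupp A ≤ msupp B ↔ ∃ Z, A = B * Z := by
  constructor
  · intro h
    have : ∀ j, ∃ v, B.mulVec v = A.mulVec (Pi.single j 1) := fun j => by
      have : A.mulVec (Pi.single j 1) ∈ msupp B := h ⟨_, rfl⟩
      obtain ⟨v, hv⟩ := this
      exact ⟨v, hv⟩
    choose v hv using this
    refine ⟨Matrix.of fun i j => v j i, ?_⟩
    ext i j
    have := congrFun (hv j) i
    rw [Matrix.mulVec_single_one] at this
    simp only [Matrix.col_apply] at this
    rw [← this]
    simp [Matrix.mulVec, dotProduct, Matrix.mul_apply]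
  · rintro ⟨Z, rfl⟩
    rintro _ ⟨v, rfl⟩
    exact ⟨Z.mulVec v, by simp⟩

lemma mpow_zero_mul_of_msupp_le {A B : Matrix ι ι ℂ} (hB : B.PosSemidef)
    (h : msupp A ≤ msupp B) : mpow B ((0 : ℝ) : ℂ) * A = A := by
  obtain ⟨Z, rfl⟩ := msupp_le_iff.mp h
  rw [← Matrix.mul_assoc, mpow_zero_mul_self hB]

lemma mul_mpow_zero_of_msupp_le {A B : Matrix ι ι ℂ} (hA : A.IsHermitian) (hB : B.PosSemidef)
    (h : msupp A ≤ msupp B) : A * mpow B ((0 : ℝ) : ℂ) = A := by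
  have := congrArg Matrix.conjTranspose (mpow_zero_mul_of_msupp_le hB h)
  rwa [Matrix.conjTranspose_mul, hA.eq, (mpow_posSemidef hB 0).1.eq] at this

lemma conjTranspose_diagonal_mul_apply (G : Matrix ι ι ℂ) (s : ι → ℝ) (i : ι) :
    (G.conjTranspose * Matrix.diagonal (fun j => (s j : ℂ)) * G) i i =
      ((∑ j, Complex.normSq (G j i) * s j : ℝ) : ℂ) := by
  rw [Matrix.mul_apply]
  push_cast
  refine Finset.sum_congr rfl fun j _ => ?_
  rw [Matrix.mul_diagonal, Matrix.conjTranspose_apply, Complex.normSq_eq_conj_mul_self]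
  simp only [RCLike.star_def]
  ring

lemma rtr_conjDiag_mul (U : Matrix ι ι ℂ) (a : ι → ℝ) (B : Matrix ι ι ℂ) :
    rtr (conjDiag U a * B) = ∑ i, a i * ((star U * B * U) i i).re := by
  have : rtr (conjDiag U a * B) =
      rtr (Matrix.diagonal (fun i => (a i : ℂ)) * (star U * B * U)) := by
    unfold rtr conjDiag
    rw [Matrix.mul_assoc, Matrix.mul_assoc, Matrix.trace_mul_comm]
    simp only [Matrix.mul_assoc]
  rw [this]
  unfold rtr Matrix.trace
  simp [Matrix.diagonal_mul]

lemma rtr_mul_comm (A B : Matrix ι ι ℂ) : rtr (A * B) = rtr (B * A) := by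
  unfold rtr; rw [Matrix.trace_mul_comm]

lemma rtr_mul_nonneg {A B : Matrix ι ι ℂ} (hA : A.PosSemidef) (hB : B.PosSemidef) :
    0 ≤ rtr (A * B) := by
  obtain ⟨U, a, hU, ha, rfl⟩ := exists_conjDiag hA
  rw [rtr_conjDiag_mul]
  refine Finset.sum_nonneg fun i _ => mul_nonneg (ha i) ?_
  have : (star U * B * U).PosSemidef := by
    rw [Matrix.star_eq_conjTranspose]; exact hB.conjTranspose_mul_mul_same U
  exact (Complex.nonneg_iff.mp (this.diag_nonneg (i := i))).1

lemma sum_normSq_col {G : Matrix ι ι ℂ} (hG : star G * G = 1) (i : ι) :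
    ∑ j, Complex.normSq (G j i) = 1 := by
  have h := congrFun (congrFun hG i) i
  have h2 := conjTranspose_diagonal_mul_apply G (fun _ => 1) i
  simp only [Complex.ofReal_one, Matrix.diagonal_one, mul_one] at h2
  rw [Matrix.star_eq_conjTranspose, h2, Matrix.one_apply_eq] at h
  exact_mod_cast h

lemma sum_normSq_row {G : Matrix ι ι ℂ} (hG : star G * G = 1) (j : ι) :
    ∑ i, Complex.normSq (G j i) = 1 := by
  have hG' : star (star G) * star G = 1 := by rw [star_star]; exact mul_eq_one_comm.mp hG
  have := sum_normSq_col hG' j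
  simpa [Matrix.star_apply] using this

/-- Hölder's inequality for the trace of a product of two positive semidefinite matrices. -/
lemma rtr_mul_le_holder {X Y : Matrix ι ι ℂ} (hX : X.PosSemidef) (hY : Y.PosSemidef)
    {p q : ℝ} (hpq : p.HolderConjugate q) :
    rtr (X * Y) ≤ rtr (mpow X (p : ℂ)) ^ (1 / p) * rtr (mpow Y (q : ℂ)) ^ (1 / q) := by
  obtain ⟨U, x, hU, hx, rfl⟩ := exists_conjDiag hX
  obtain ⟨V, y, hV, hy, rfl⟩ := exists_conjDiag hY
  have hp := hpq.pos
  have hq := hpq.symm.pos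
  rw [mpow_conjDiag_real hU hx, mpow_conjDiag_real hV hy, rtr_conjDiag hU, rtr_conjDiag hV,
    rtr_conjDiag_mul]
  simp only [rp_eq_rpow hp.ne', rp_eq_rpow hq.ne']
  set G := star V * U with hGdef
  have hG : star G * G = 1 := by
    rw [hGdef, star_mul, star_star]
    calc _ = star U * (V * star V) * U := by simp only [Matrix.mul_assoc]
      _ = 1 := by rw [mul_eq_one_comm.mp hV, Matrix.mul_one, hU]
  have hdiag : ∀ i, ((star U * conjDiag V y * U) i i).re =
      ∑ j, Complex.normSq (G j i) * y j := by
    intro i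
    have : star U * conjDiag V y * U =
        G.conjTranspose * Matrix.diagonal (fun j => (y j : ℂ)) * G := by
      rw [hGdef, ← Matrix.star_eq_conjTranspose, star_mul, star_star]
      unfold conjDiag
      simp only [Matrix.mul_assoc]
    rw [this, conjTranspose_diagonal_mul_apply, Complex.ofReal_re]
  simp only [hdiag]
  have hn : ∀ i j, 0 ≤ Complex.normSq (G j i) := fun i j => Complex.normSq_nonneg _
  have key := Real.inner_le_Lp_mul_Lq_of_nonneg (s := (Finset.univ : Finset (ι × ι)))
    (f := fun z => Complex.normSq (G z.2 z.1) ^ (1 / p) * x z.1)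
    (g := fun z => Complex.normSq (G z.2 z.1) ^ (1 / q) * y z.2) hpq
    (fun z _ => mul_nonneg (Real.rpow_nonneg (hn _ _) _) (hx _))
    (fun z _ => mul_nonneg (Real.rpow_nonneg (hn _ _) _) (hy _))
  have e1 : ∀ z : ι × ι, (Complex.normSq (G z.2 z.1) ^ (1 / p) * x z.1) ^ p =
      Complex.normSq (G z.2 z.1) * x z.1 ^ p := fun z => by
    rw [Real.mul_rpow (Real.rpow_nonneg (hn _ _) _) (hx _), ← Real.rpow_mul (hn _ _),
      one_div_mul_cancel hp.ne', Real.rpow_one]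
  have e2 : ∀ z : ι × ι, (Complex.normSq (G z.2 z.1) ^ (1 / q) * y z.2) ^ q =
      Complex.normSq (G z.2 z.1) * y z.2 ^ q := fun z => by
    rw [Real.mul_rpow (Real.rpow_nonneg (hn _ _) _) (hy _), ← Real.rpow_mul (hn _ _),
      one_div_mul_cancel hq.ne', Real.rpow_one]
  have e3 : ∀ z : ι × ι, (Complex.normSq (G z.2 z.1) ^ (1 / p) * x z.1) *
      (Complex.normSq (G z.2 z.1) ^ (1 / q) * y z.2) =
      x z.1 * (Complex.normSq (G z.2 z.1) * y z.2) := fun z => by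
    have : Complex.normSq (G z.2 z.1) ^ (1 / p) * Complex.normSq (G z.2 z.1) ^ (1 / q) =
        Complex.normSq (G z.2 z.1) := by
      rw [← Real.rpow_add' (hn _ _)]
      · rw [one_div, one_div, hpq.inv_add_inv_eq_one, Real.rpow_one]
      · rw [one_div, one_div, hpq.inv_add_inv_eq_one]; exact one_ne_zero
    calc _ = x z.1 * (Complex.normSq (G z.2 z.1) ^ (1 / p) *
          Complex.normSq (G z.2 z.1) ^ (1 / q)) * y z.2 := by ring
      _ = _ := by rw [this]; ring
  simp only [e1, e2, e3] at key
  rw [Fintype.sum_prod_type, Fintype.sum_prod_type, Fintype.sum_prod_type_right] at key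
  simp only [← Finset.mul_sum, ← Finset.sum_mul, sum_normSq_col hG, sum_normSq_row hG,
    one_mul] at key
  exact key

/-- Trace Jensen inequality for the convex function `x ↦ x ^ (1 / β)` and a contraction. -/
lemma rtr_mpow_conj_le {T σ : Matrix ι ι ℂ} (hT : IsTest T) (hσ : σ.PosSemidef)
    {β : ℝ} (hβ0 : 0 < β) (hβ1 : β < 1) :
    rtr (mpow (mpow T ((1 / 2 : ℝ) : ℂ) * mpow σ (β : ℂ) * mpow T ((1 / 2 : ℝ) : ℂ))
      ((1 / β : ℝ) : ℂ)) ≤ rtr (σ * T) := by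
  set K := mpow T ((1 / 2 : ℝ) : ℂ) with hK
  have hKh : K.conjTranspose = K := (mpow_posSemidef hT.1 _).1.eq
  have hKK : K * K = T := by
    rw [hK, mpow_mul_mpow hT.1, add_halves, mpow_one hT.1]
  have hYpsd : (K * mpow σ (β : ℂ) * K).PosSemidef := by
    have := (mpow_posSemidef hσ β).mul_mul_conjTranspose_same K
    rwa [hKh] at this
  obtain ⟨V, y, hV, hy, hYe⟩ := exists_conjDiag hYpsd
  obtain ⟨W, s, hW, hs, rfl⟩ := exists_conjDiag hσ
  have hq : (1 / β : ℝ) ≠ 0 := (one_div_pos.mpr hβ0).ne'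
  rw [hYe, mpow_conjDiag_real hV hy, rtr_conjDiag hV]
  simp only [rp_eq_rpow hq]
  set G := star W * K * V with hG
  have hGc : ∀ a : ι → ℝ, G.conjTranspose * Matrix.diagonal (fun j => (a j : ℂ)) * G =
      star V * (K * conjDiag W a * K) * V := by
    intro a
    rw [hG, ← Matrix.star_eq_conjTranspose, star_mul, star_mul, star_star,
      Matrix.star_eq_conjTranspose K, hKh]
    unfold conjDiag
    simp only [Matrix.mul_assoc]
  have hyi : ∀ i, y i = ∑ j, Complex.normSq (G j i) * s j ^ β := by
    intro i
    have h1 := conjTranspose_diagonal_mul_apply G (fun j => s j ^ β) i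
    rw [hGc] at h1
    have h2 : conjDiag W (fun j => s j ^ β) = mpow (conjDiag W s) (β : ℂ) := by
      rw [mpow_conjDiag_real hW hs]; simp only [rp_eq_rpow hβ0.ne']
    rw [h2, hYe] at h1
    have h3 : star V * conjDiag V y * V = Matrix.diagonal (fun i => (y i : ℂ)) := by
      unfold conjDiag
      calc _ = (star V * V) * Matrix.diagonal (fun i => (y i : ℂ)) * (star V * V) := by
            simp only [Matrix.mul_assoc]
        _ = _ := by rw [hV, Matrix.one_mul, Matrix.mul_one]
    rw [h3, Matrix.diagonal_apply_eq] at h1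
    exact_mod_cast h1
  have hw : ∀ i, ∑ j, Complex.normSq (G j i) ≤ 1 := by
    intro i
    have h1 := conjTranspose_diagonal_mul_apply G (fun _ => 1) i
    rw [hGc] at h1
    have h2 : conjDiag W (fun _ => 1) = 1 := by
      unfold conjDiag; simpa using mul_eq_one_comm.mp hW
    rw [h2, Matrix.mul_one, hKK] at h1
    have h3 : (star V * (1 - T) * V).PosSemidef := by
      rw [Matrix.star_eq_conjTranspose]; exact hT.2.conjTranspose_mul_mul_same V
    have h4 := (Complex.nonneg_iff.mp (h3.diag_nonneg (i := i))).1
    rw [Matrix.mul_sub, Matrix.sub_mul, Matrix.mul_one, hV, Matrix.sub_apply, h1] at h4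
    simpa using h4
  have hsum : rtr (conjDiag W s * T) = ∑ i, ∑ j, Complex.normSq (G j i) * s j := by
    have h0 : rtr (conjDiag W s * T) = rtr (star V * (K * conjDiag W s * K) * V) := by
      rw [rtr_mul_comm (star V * _) V, ← Matrix.mul_assoc V, mul_eq_one_comm.mp hV,
        Matrix.one_mul, rtr_mul_comm _ K, ← Matrix.mul_assoc, hKK, rtr_mul_comm]
    rw [h0, ← hGc]
    unfold rtr Matrix.trace
    rw [Complex.re_sum]
    refine Finset.sum_congr rfl fun i _ => ?_
    rw [Matrix.diag_apply, conjTranspose_diagonal_mul_apply, Complex.ofReal_re]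
  rw [hsum]
  refine Finset.sum_le_sum fun i _ => ?_
  rw [hyi]
  have hb : (1 : ℝ) ≤ 1 / β := by rw [le_div_iff₀ hβ0]; linarith
  have hJ := Real.inner_le_weight_mul_Lp_of_nonneg (Finset.univ : Finset ι) hb
    (fun j => Complex.normSq (G j i)) (fun j => s j ^ β)
    (fun j => Complex.normSq_nonneg _) (fun j => Real.rpow_nonneg (hs j) _)
  have hss : ∀ j, (s j ^ β) ^ (1 / β) = s j := fun j => by
    rw [← Real.rpow_mul (hs j), mul_one_div_cancel hβ0.ne', Real.rpow_one]
  simp only [hss] at hJ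
  have hA0 : 0 ≤ ∑ j, Complex.normSq (G j i) * s j :=
    Finset.sum_nonneg fun j _ => mul_nonneg (Complex.normSq_nonneg _) (hs j)
  have hN0 : 0 ≤ ∑ j, Complex.normSq (G j i) :=
    Finset.sum_nonneg fun j _ => Complex.normSq_nonneg _
  have hle : ∑ j, Complex.normSq (G j i) * s j ^ β ≤
      (∑ j, Complex.normSq (G j i) * s j) ^ β := by
    refine hJ.trans ?_
    rw [one_div, inv_inv]
    refine mul_le_of_le_one_left (Real.rpow_nonneg hA0 _) ?_
    exact Real.rpow_le_one hN0 (hw i) (by linarith)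
  calc _ ≤ ((∑ j, Complex.normSq (G j i) * s j) ^ β) ^ (1 / β) := by
        refine Real.rpow_le_rpow ?_ hle (by positivity)
        exact Finset.sum_nonneg fun j _ =>
          mul_nonneg (Complex.normSq_nonneg _) (Real.rpow_nonneg (hs j) _)
    _ = _ := by rw [← Real.rpow_mul hA0, mul_one_div_cancel hβ0.ne', Real.rpow_one]

lemma sandwich_posSemidef {ρ σ : Matrix ι ι ℂ} (hρ : ρ.PosSemidef) (hσ : σ.PosSemidef) (g : ℝ) :
    (mpow σ (g : ℂ) * ρ * mpow σ (g : ℂ)).PosSemidef := by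
  have := hρ.mul_mul_conjTranspose_same (mpow σ (g : ℂ))
  rwa [(mpow_posSemidef hσ g).1.eq] at this

lemma Qsand_nonneg {ρ σ : Matrix ι ι ℂ} (hρ : ρ.PosSemidef) (hσ : σ.PosSemidef) (α : ℝ) :
    0 ≤ Qsand α ρ σ :=
  (Complex.nonneg_iff.mp (mpow_posSemidef (sandwich_posSemidef hρ hσ _) α).trace_nonneg).1

/-- Strong converse inequality: the sandwiched quasi-entropy controls every test. -/
lemma rtr_test_le {ρ σ T : Matrix ι ι ℂ} (hρ : ρ.PosSemidef) (hσ : σ.PosSemidef)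
    (hsupp : msupp ρ ≤ msupp σ) (hT : IsTest T) {α : ℝ} (hα : 1 < α) :
    rtr (T * ρ) ≤ Qsand α ρ σ ^ (1 / α) * rtr (σ * T) ^ ((α - 1) / α) := by
  have hα0 : 0 < α := by linarith
  set g : ℝ := (1 - α) / (2 * α) with hg
  set β : ℝ := (α - 1) / α with hβ
  have hgβ : -g + -g = β := by rw [hg, hβ]; field_simp; ring
  have hβ0 : 0 < β := div_pos (by linarith) hα0
  have hβ1 : β < 1 := by rw [hβ, div_lt_one hα0]; linarith
  set X := mpow σ (g : ℂ) * ρ * mpow σ (g : ℂ) with hX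
  set s := mpow σ ((-g : ℝ) : ℂ) with hs
  have hsh : s.conjTranspose = s := (mpow_posSemidef hσ _).1.eq
  have hρX : s * X * s = ρ := by
    calc s * X * s = (s * mpow σ (g : ℂ)) * ρ * (mpow σ (g : ℂ) * s) := by
          rw [hX]; simp only [Matrix.mul_assoc]
      _ = ρ := by
          rw [hs, mpow_mul_mpow hσ, mpow_mul_mpow hσ, neg_add_cancel, add_neg_cancel,
            mpow_zero_mul_of_msupp_le hσ hsupp, mul_mpow_zero_of_msupp_le hρ.1 hσ hsupp]
  set K := mpow T ((1 / 2 : ℝ) : ℂ) with hK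
  have hKh : K.conjTranspose = K := (mpow_posSemidef hT.1 _).1.eq
  have hKK : K * K = T := by
    rw [hK, mpow_mul_mpow hT.1, add_halves, mpow_one hT.1]
  have hY : (K * s).conjTranspose * (K * s) = s * T * s := by
    rw [Matrix.conjTranspose_mul, hsh, hKh, ← hKK]; simp only [Matrix.mul_assoc]
  have hY' : (K * s) * (K * s).conjTranspose = K * mpow σ (β : ℂ) * K := by
    rw [Matrix.conjTranspose_mul, hsh, hKh, ← hgβ, ← mpow_mul_mpow hσ]
    simp only [Matrix.mul_assoc, hs]
  have hpq : α.HolderConjugate (1 / β) := by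
    rw [Real.holderConjugate_iff]
    refine ⟨hα, ?_⟩
    rw [one_div, inv_inv, hβ]; field_simp; ring
  have h1 : rtr (T * ρ) = rtr (X * (s * T * s)) := by
    rw [← hρX]
    calc _ = rtr ((T * s * X) * s) := by simp only [Matrix.mul_assoc]
      _ = rtr ((s * T * s) * X) := by rw [rtr_mul_comm]; simp only [Matrix.mul_assoc]
      _ = _ := rtr_mul_comm _ _
  have hYpsd : (s * T * s).PosSemidef := hY ▸ Matrix.posSemidef_conjTranspose_mul_self _
  rw [h1]
  refine (rtr_mul_le_holder (sandwich_posSemidef hρ hσ g) hYpsd hpq).trans ?_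
  refine mul_le_mul_of_nonneg_left ?_ (Real.rpow_nonneg (Qsand_nonneg hρ hσ α) _)
  rw [one_div_one_div, ← hY, rtr_mpow_conjTranspose_mul_comm, hY']
  refine Real.rpow_le_rpow ?_ (rtr_mpow_conj_le hT hσ hβ0 hβ1) hβ0.le
  have : (K * mpow σ (β : ℂ) * K).PosSemidef := hY' ▸ Matrix.posSemidef_self_mul_conjTranspose _
  exact (Complex.nonneg_iff.mp (mpow_posSemidef this _).trace_nonneg).1

lemma isTest_one : IsTest (1 : Matrix ι ι ℂ) :=
  ⟨Matrix.PosSemidef.one, by rw [sub_self]; exact Matrix.PosSemidef.zero⟩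

lemma Qsand_pos {ρ σ : Matrix ι ι ℂ} (hρ : ρ.PosSemidef) (hρ1 : rtr ρ = 1) (hσ : σ.PosSemidef)
    (hsupp : msupp ρ ≤ msupp σ) {α : ℝ} (hα : 1 < α) : 0 < Qsand α ρ σ := by
  refine lt_of_le_of_ne (Qsand_nonneg hρ hσ α) fun h => ?_
  have := rtr_test_le hρ hσ hsupp isTest_one hα
  rw [← h, Matrix.one_mul, hρ1, Real.zero_rpow (one_div_pos.mpr (by linarith)).ne'] at this
  linarith

/-- The sandwiched Rényi divergences of finite order `α > 1` are uniformly bounded. -/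
lemma exists_log_Qsand_le {ρ σ : Matrix ι ι ℂ} (hρ : ρ.PosSemidef) (hρ1 : rtr ρ = 1)
    (hσ : σ.PosSemidef) (hsupp : msupp ρ ≤ msupp σ) :
    ∃ C : ℝ, ∀ α : ℝ, 1 < α → Real.log (Qsand α ρ σ) ≤ (α - 1) * C := by
  obtain ⟨W, s, hW, hs, hσe⟩ := exists_conjDiag hσ
  set Λ : ℝ := 1 + ∑ i, (s i)⁻¹ with hΛ
  have hΛ1 : 1 ≤ Λ := by
    have : 0 ≤ ∑ i, (s i)⁻¹ := Finset.sum_nonneg fun i _ => inv_nonneg.mpr (hs i)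
    linarith
  have hΛ0 : 0 < Λ := by linarith
  have hsΛ : ∀ i, (s i)⁻¹ ≤ Λ := fun i => by
    have := Finset.single_le_sum (f := fun i => (s i)⁻¹) (fun i _ => inv_nonneg.mpr (hs i))
      (Finset.mem_univ i)
    linarith
  refine ⟨Real.log Λ, fun α hα => ?_⟩
  have hα0 : 0 < α := by linarith
  have hQ := Qsand_pos hρ hρ1 hσ hsupp hα
  rw [← Real.log_rpow hΛ0]
  refine Real.log_le_log hQ ?_
  set g : ℝ := (1 - α) / (2 * α) with hg
  set β : ℝ := (α - 1) / α with hβ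
  have hβ0 : 0 < β := div_pos (by linarith) hα0
  have hXpsd := sandwich_posSemidef hρ hσ g
  have htr : rtr (mpow σ (g : ℂ) * ρ * mpow σ (g : ℂ)) ≤ Λ ^ β := by
    rw [rtr_mul_comm, ← Matrix.mul_assoc, mpow_mul_mpow hσ]
    have : g + g = -β := by rw [hg, hβ]; field_simp; ring
    rw [this, hσe, mpow_conjDiag_real hW hs, rtr_conjDiag_mul]
    have hd : ∀ i, 0 ≤ ((star W * ρ * W) i i).re := fun i => by
      have : (star W * ρ * W).PosSemidef := by
        rw [Matrix.star_eq_conjTranspose]; exact hρ.conjTranspose_mul_mul_same W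
      exact (Complex.nonneg_iff.mp (this.diag_nonneg (i := i))).1
    have hd1 : ∑ i, ((star W * ρ * W) i i).re = 1 := by
      have : rtr (star W * ρ * W) = 1 := by
        rw [rtr_mul_comm, ← Matrix.mul_assoc, mul_eq_one_comm.mp hW, Matrix.one_mul, hρ1]
      rw [← this]; unfold rtr Matrix.trace; rw [Complex.re_sum]; rfl
    have hr : ∀ i, rp (-β) (s i) ≤ Λ ^ β := fun i => by
      unfold rp; split_ifs with h
      · exact Real.rpow_nonneg hΛ0.le _
      · rw [Real.rpow_neg (hs i), ← Real.inv_rpow (hs i)]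
        exact Real.rpow_le_rpow (inv_nonneg.mpr (hs i)) (hsΛ i) hβ0.le
    calc _ ≤ ∑ i, Λ ^ β * ((star W * ρ * W) i i).re :=
          Finset.sum_le_sum fun i _ => mul_le_mul_of_nonneg_right (hr i) (hd i)
      _ = Λ ^ β := by rw [← Finset.mul_sum, hd1, mul_one]
  unfold Qsand
  rw [← hg]
  obtain ⟨U, x, hU, hx, hXe⟩ := exists_conjDiag hXpsd
  rw [hXe, rtr_conjDiag hU] at htr
  rw [hXe, mpow_conjDiag_real hU hx, rtr_conjDiag hU]
  simp only [rp_eq_rpow hα0.ne']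
  have hxi : ∀ i, x i ≤ Λ ^ β := fun i =>
    (Finset.single_le_sum (fun i _ => hx i) (Finset.mem_univ i)).trans htr
  have hL0 : 0 < Λ ^ β := Real.rpow_pos_of_pos hΛ0 _
  calc ∑ i, x i ^ α ≤ ∑ i, x i * (Λ ^ β) ^ (α - 1) := by
        refine Finset.sum_le_sum fun i _ => ?_
        have : x i ^ α = x i * x i ^ (α - 1) := by
          rcases eq_or_lt_of_le (hx i) with h | h
          · rw [← h, Real.zero_rpow hα0.ne', zero_mul]
          · conv_rhs => enter [1]; rw [← Real.rpow_one (x i)]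
            rw [← Real.rpow_add h]; congr 1; ring
        rw [this]
        exact mul_le_mul_of_nonneg_left
          (Real.rpow_le_rpow (hx i) (hxi i) (by linarith)) (hx i)
    _ = (∑ i, x i) * (Λ ^ β) ^ (α - 1) := by rw [Finset.sum_mul]
    _ ≤ Λ ^ β * (Λ ^ β) ^ (α - 1) :=
        mul_le_mul_of_nonneg_right htr (Real.rpow_nonneg hL0.le _)
    _ = Λ ^ (α - 1) := by
        rw [← Real.rpow_mul hΛ0.le, ← Real.rpow_add hΛ0]
        congr 1
        rw [hβ]; field_simp; ring

section Tensor

variable {d m n : ℕ}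

lemma tensOp_eq_submatrix (A : Matrix (Fin m → Fin d) (Fin m → Fin d) ℂ)
    (B : Matrix (Fin n → Fin d) (Fin n → Fin d) ℂ) :
    tensOp A B = (Matrix.kroneckerMap (fun x y => x * y) A B).submatrix
      (Fin.appendEquiv m n).symm (Fin.appendEquiv m n).symm := rfl

lemma tensOp_mul (A A' : Matrix (Fin m → Fin d) (Fin m → Fin d) ℂ)
    (B B' : Matrix (Fin n → Fin d) (Fin n → Fin d) ℂ) :
    tensOp A B * tensOp A' B' = tensOp (A * A') (B * B') := by
  simp only [tensOp_eq_submatrix]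
  rw [Matrix.submatrix_mul_equiv, ← Matrix.mul_kronecker_mul]

lemma tensOp_conjTranspose (A : Matrix (Fin m → Fin d) (Fin m → Fin d) ℂ)
    (B : Matrix (Fin n → Fin d) (Fin n → Fin d) ℂ) :
    (tensOp A B).conjTranspose = tensOp A.conjTranspose B.conjTranspose := by
  ext x y
  simp [tensOp, Matrix.conjTranspose_apply]

lemma tensOp_diagonal (a : (Fin m → Fin d) → ℂ) (b : (Fin n → Fin d) → ℂ) :
    tensOp (Matrix.diagonal a) (Matrix.diagonal b) =
      Matrix.diagonal (fun x => a (fun i => x (Fin.castAdd n i)) *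
        b (fun j => x (Fin.natAdd m j))) := by
  rw [tensOp_eq_submatrix]
  have := Matrix.diagonal_kronecker_diagonal a b
  rw [this, Matrix.submatrix_diagonal_equiv]
  rfl

lemma tensOp_one : tensOp (1 : Matrix (Fin m → Fin d) (Fin m → Fin d) ℂ)
    (1 : Matrix (Fin n → Fin d) (Fin n → Fin d) ℂ) = 1 := by
  rw [← Matrix.diagonal_one, ← Matrix.diagonal_one, tensOp_diagonal]
  simp

lemma tensOp_posSemidef {A : Matrix (Fin m → Fin d) (Fin m → Fin d) ℂ}
    {B : Matrix (Fin n → Fin d) (Fin n → Fin d) ℂ} (hA : A.PosSemidef) (hB : B.PosSemidef) :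
    (tensOp A B).PosSemidef := by
  rw [tensOp_eq_submatrix]
  exact (hA.kronecker hB).submatrix _

lemma trace_tensOp (A : Matrix (Fin m → Fin d) (Fin m → Fin d) ℂ)
    (B : Matrix (Fin n → Fin d) (Fin n → Fin d) ℂ) :
    (tensOp A B).trace = A.trace * B.trace := by
  have h := Matrix.trace_kronecker A B
  rw [← h, tensOp_eq_submatrix]
  unfold Matrix.trace
  exact Fintype.sum_equiv (Fin.appendEquiv m n).symm _ _ fun x => rfl

lemma rtr_tensOp {A : Matrix (Fin m → Fin d) (Fin m → Fin d) ℂ} (hA : A.trace.im = 0)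
    (B : Matrix (Fin n → Fin d) (Fin n → Fin d) ℂ) :
    rtr (tensOp A B) = rtr A * rtr B := by
  unfold rtr
  rw [trace_tensOp, Complex.mul_re, hA, zero_mul, sub_zero]

lemma tensOp_conjDiag (U : Matrix (Fin m → Fin d) (Fin m → Fin d) ℂ)
    (V : Matrix (Fin n → Fin d) (Fin n → Fin d) ℂ) (a : (Fin m → Fin d) → ℝ)
    (b : (Fin n → Fin d) → ℝ) :
    tensOp (conjDiag U a) (conjDiag V b) =
      conjDiag (tensOp U V) (fun x => a (fun i => x (Fin.castAdd n i)) *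
        b (fun j => x (Fin.natAdd m j))) := by
  unfold conjDiag
  rw [← tensOp_mul, ← tensOp_mul, tensOp_diagonal, Matrix.star_eq_conjTranspose,
    Matrix.star_eq_conjTranspose, Matrix.star_eq_conjTranspose, tensOp_conjTranspose]
  simp

lemma mpow_tensOp {A : Matrix (Fin m → Fin d) (Fin m → Fin d) ℂ}
    {B : Matrix (Fin n → Fin d) (Fin n → Fin d) ℂ} (hA : A.PosSemidef) (hB : B.PosSemidef)
    (t : ℝ) : mpow (tensOp A B) (t : ℂ) = tensOp (mpow A (t : ℂ)) (mpow B (t : ℂ)) := by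
  obtain ⟨U, a, hU, ha, rfl⟩ := exists_conjDiag hA
  obtain ⟨V, b, hV, hb, rfl⟩ := exists_conjDiag hB
  have hUV : star (tensOp U V) * tensOp U V = 1 := by
    rw [Matrix.star_eq_conjTranspose, tensOp_conjTranspose, tensOp_mul,
      ← Matrix.star_eq_conjTranspose, ← Matrix.star_eq_conjTranspose, hU, hV, tensOp_one]
  rw [tensOp_conjDiag, mpow_conjDiag_real hUV fun i => mul_nonneg (ha _) (hb _),
    mpow_conjDiag_real hU ha, mpow_conjDiag_real hV hb, tensOp_conjDiag]
  simp only [rp_mul_base t (ha _) (hb _)]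

lemma trace_im_eq_zero {A : Matrix ι ι ℂ} (hA : A.IsHermitian) : A.trace.im = 0 := by
  have := congrArg Matrix.trace hA.eq
  rw [Matrix.trace_conjTranspose] at this
  exact Complex.conj_eq_iff_im.mp this

lemma trace_mul_im_eq_zero {A B : Matrix ι ι ℂ} (hA : A.IsHermitian) (hB : B.IsHermitian) :
    (A * B).trace.im = 0 := by
  have := Matrix.trace_conjTranspose (A * B)
  rw [Matrix.conjTranspose_mul, hA.eq, hB.eq, Matrix.trace_mul_comm] at this
  exact Complex.conj_eq_iff_im.mp this.symm

lemma Qsand_tensOp {ρ σ : Matrix (Fin m → Fin d) (Fin m → Fin d) ℂ}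
    {ρ' σ' : Matrix (Fin n → Fin d) (Fin n → Fin d) ℂ} (hρ : ρ.PosSemidef) (hσ : σ.PosSemidef)
    (hρ' : ρ'.PosSemidef) (hσ' : σ'.PosSemidef) (α : ℝ) :
    Qsand α (tensOp ρ ρ') (tensOp σ σ') = Qsand α ρ σ * Qsand α ρ' σ' := by
  unfold Qsand
  rw [mpow_tensOp hσ hσ', tensOp_mul, tensOp_mul,
    mpow_tensOp (sandwich_posSemidef hρ hσ _) (sandwich_posSemidef hρ' hσ' _),
    rtr_tensOp (trace_im_eq_zero (mpow_posSemidef (sandwich_posSemidef hρ hσ _) α).1)]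

lemma msupp_tensOp_le {ρ σ : Matrix (Fin m → Fin d) (Fin m → Fin d) ℂ}
    {ρ' σ' : Matrix (Fin n → Fin d) (Fin n → Fin d) ℂ} (h : msupp ρ ≤ msupp σ)
    (h' : msupp ρ' ≤ msupp σ') : msupp (tensOp ρ ρ') ≤ msupp (tensOp σ σ') := by
  obtain ⟨Z, rfl⟩ := msupp_le_iff.mp h
  obtain ⟨Z', rfl⟩ := msupp_le_iff.mp h'
  exact msupp_le_iff.mpr ⟨tensOp Z Z', (tensOp_mul _ _ _ _).symm⟩

lemma tpow_add (ρ : Matrix (Fin d) (Fin d) ℂ) (m n : ℕ) :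
    tpow ρ (m + n) = tensOp (tpow ρ m) (tpow ρ n) := by
  ext x y
  simp [tpow, tensOp, Fin.prod_univ_add]

lemma tpow_zero (ρ : Matrix (Fin d) (Fin d) ℂ) : tpow ρ 0 = 1 := by
  ext x y
  rw [Subsingleton.elim x y, Matrix.one_apply_eq]
  simp [tpow]

lemma tpow_one (ρ : Matrix (Fin d) (Fin d) ℂ) :
    tpow ρ 1 = ρ.submatrix (Equiv.funUnique (Fin 1) (Fin d)) (Equiv.funUnique (Fin 1) (Fin d)) := by
  ext x y
  simp [tpow]

lemma tpow_posSemidef {ρ : Matrix (Fin d) (Fin d) ℂ} (hρ : ρ.PosSemidef) (n : ℕ) :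
    (tpow ρ n).PosSemidef := by
  induction n with
  | zero => rw [tpow_zero]; exact Matrix.PosSemidef.one
  | succ n ih =>
    rw [tpow_add]
    exact tensOp_posSemidef ih (by rw [tpow_one]; exact hρ.submatrix _)

lemma trace_tpow {ρ : Matrix (Fin d) (Fin d) ℂ} (hρ : ρ.trace = 1) (n : ℕ) :
    (tpow ρ n).trace = 1 := by
  induction n with
  | zero => rw [tpow_zero]; simp
  | succ n ih =>
    rw [tpow_add, trace_tensOp, ih, one_mul, tpow_one, ← hρ]
    unfold Matrix.trace
    exact Fintype.sum_equiv (Equiv.funUnique (Fin 1) (Fin d)) _ _ fun x => rfl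

lemma rtr_tpow {ρ : Matrix (Fin d) (Fin d) ℂ} (hρ : ρ.trace = 1) (n : ℕ) :
    rtr (tpow ρ n) = 1 := by
  unfold rtr; rw [trace_tpow hρ]; rfl

lemma tensOp_sum_sum {κ κ' : Type*} [Fintype κ] [Fintype κ']
    (A : κ → Matrix (Fin m → Fin d) (Fin m → Fin d) ℂ)
    (B : κ' → Matrix (Fin n → Fin d) (Fin n → Fin d) ℂ) :
    tensOp (∑ i, A i) (∑ j, B j) = ∑ i, ∑ j, tensOp (A i) (B j) := by
  ext x y
  simp only [tensOp, Matrix.of_apply, Matrix.sum_apply]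
  rw [Finset.sum_mul_sum]

lemma tensOp_smul_smul (a b : ℝ) (A : Matrix (Fin m → Fin d) (Fin m → Fin d) ℂ)
    (B : Matrix (Fin n → Fin d) (Fin n → Fin d) ℂ) :
    tensOp (a • A) (b • B) = (a * b) • tensOp A B := by
  ext x y
  simp only [tensOp, Matrix.of_apply, Matrix.smul_apply, Complex.real_smul]
  push_cast; ring

end Tensor

section Classical

variable {κ : Type*} [Fintype κ]

lemma sum_prod_cons {A : Type*} [AddCommMonoid A] {N : ℕ} (F : (Fin (N + 1) → κ) → A) :
    ∑ x, F x = ∑ k, ∑ x : Fin N → κ, F (Fin.cons k x) := by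
  rw [← Fintype.sum_prod_type']
  exact (Fintype.sum_equiv (Fin.consEquiv fun _ => κ) _ _ fun x => rfl).symm

lemma sum_iid_one {t : κ → ℝ} (ht : ∑ k, t k = 1) (N : ℕ) :
    ∑ x : Fin N → κ, ∏ i, t (x i) = 1 := by
  induction N with
  | zero => simp
  | succ N ih =>
    rw [sum_prod_cons]
    simp only [Fin.prod_univ_succ, Fin.cons_zero, Fin.cons_succ, ← Finset.mul_sum, ih, mul_one, ht]

lemma sum_iid_add {t : κ → ℝ} (ht : ∑ k, t k = 1) (g : κ → ℝ) (N : ℕ) :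
    ∑ x : Fin N → κ, (∏ i, t (x i)) * ∑ i, g (x i) = N * ∑ k, t k * g k := by
  induction N with
  | zero => simp
  | succ N ih =>
    rw [sum_prod_cons]
    simp only [Fin.prod_univ_succ, Fin.sum_univ_succ, Fin.cons_zero, Fin.cons_succ]
    have : ∀ k, ∑ x : Fin N → κ, t k * (∏ i, t (x i)) * (g k + ∑ i, g (x i)) =
        t k * g k + t k * (N * ∑ k, t k * g k) := by
      intro k
      have : ∀ x : Fin N → κ, t k * (∏ i, t (x i)) * (g k + ∑ i, g (x i)) =
        (t k * g k) * (∏ i, t (x i)) + t k * ((∏ i, t (x i)) * ∑ i, g (x i)) := fun x => by ring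
      simp only [this, Finset.sum_add_distrib, ← Finset.mul_sum, ih, sum_iid_one ht, mul_one]
    simp only [this, Finset.sum_add_distrib, ← Finset.sum_mul, ht]
    push_cast; ring

lemma sum_iid_sq {t : κ → ℝ} (ht : ∑ k, t k = 1) {z : κ → ℝ} (hz : ∑ k, t k * z k = 0) (N : ℕ) :
    ∑ x : Fin N → κ, (∏ i, t (x i)) * (∑ i, z (x i)) ^ 2 = N * ∑ k, t k * z k ^ 2 := by
  induction N with
  | zero => simp
  | succ N ih =>
    rw [sum_prod_cons]
    simp only [Fin.prod_univ_succ, Fin.sum_univ_succ, Fin.cons_zero, Fin.cons_succ]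
    have : ∀ k, ∑ x : Fin N → κ, t k * (∏ i, t (x i)) * (z k + ∑ i, z (x i)) ^ 2 =
        t k * z k ^ 2 + t k * (N * ∑ k, t k * z k ^ 2) := by
      intro k
      have : ∀ x : Fin N → κ, t k * (∏ i, t (x i)) * (z k + ∑ i, z (x i)) ^ 2 =
        (t k * z k ^ 2) * (∏ i, t (x i)) + (2 * t k * z k) * ((∏ i, t (x i)) * ∑ i, z (x i)) +
          t k * ((∏ i, t (x i)) * (∑ i, z (x i)) ^ 2) := fun x => by ring
      simp only [this, Finset.sum_add_distrib, ← Finset.mul_sum, ih, sum_iid_one ht, mul_one,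
        sum_iid_add ht, hz]
      ring
    simp only [this, Finset.sum_add_distrib, ← Finset.sum_mul, ht]
    push_cast; ring

/-- A lower bound on the success probability of a likelihood-ratio type test under `p^N`,
obtained by changing the measure to `t^N`. -/
lemma exists_exp_le_sum_min {p t w : κ → ℝ} (hp : ∀ k, 0 ≤ p k) (ht : ∀ k, 0 ≤ t k)
    (hw : ∀ k, 0 ≤ w k) (ht1 : ∑ k, t k = 1) (htp : ∀ k, t k ≠ 0 → 0 < p k)
    (htw : ∀ k, t k ≠ 0 → 0 < w k) (a : ℝ) :
    ∃ K : ℝ, ∀ N : ℕ,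
      Real.exp (-(N * (∑ k, t k * (Real.log (t k) - Real.log (p k)) +
        max (a - ∑ k, t k * Real.log (w k)) 0)) - K * √N) ≤
      ∑ x : Fin N → κ, min 1 (Real.exp (-(N * a)) * ∏ i, w (x i)) * ∏ i, p (x i) := by
  set g : κ → ℝ := fun k => Real.log (t k) - Real.log (p k) with hg
  set b : ℝ := ∑ k, t k * Real.log (w k) with hb
  set z : κ → ℝ := fun k => Real.log (w k) - b with hz
  have hz0 : ∑ k, t k * z k = 0 := by
    simp only [hz, mul_sub, Finset.sum_sub_distrib, ← Finset.sum_mul, ht1, ← hb]; ring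
  set v := ∑ k, t k * z k ^ 2 with hv
  set D := ∑ k, t k * g k with hD
  set c := max (a - b) 0 with hc
  refine ⟨(v + 1) / 2, fun N => ?_⟩
  set Y : (Fin N → κ) → ℝ := fun x =>
    -∑ i, g (x i) - N * c - ((∑ i, z (x i)) ^ 2 / √N + √N) / 2 with hY
  set L : ℝ := -(N * (D + c)) - (v + 1) / 2 * √N with hL
  have hEY : ∑ x : Fin N → κ, (∏ i, t (x i)) * Y x = L := by
    have : ∀ x : Fin N → κ, (∏ i, t (x i)) * Y x =
        -((∏ i, t (x i)) * ∑ i, g (x i)) - (N * c + √N / 2) * (∏ i, t (x i)) -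
        (1 / (2 * √N)) * ((∏ i, t (x i)) * (∑ i, z (x i)) ^ 2) := fun x => by
      simp only [hY]
      rw [one_div, mul_inv]; ring
    simp only [this, Finset.sum_sub_distrib, Finset.sum_neg_distrib, ← Finset.mul_sum,
      sum_iid_one ht1, sum_iid_add ht1, sum_iid_sq ht1 hz0]
    have h2 : 1 / (2 * √(N : ℝ)) * (N * v) = v / 2 * √N := by
      rw [one_div, mul_inv, show (2 : ℝ)⁻¹ * (√(N : ℝ))⁻¹ * (N * v) = v / 2 * (N / √N) by ring,
        Real.div_sqrt]
    rw [h2, hL]; ring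
  have hterm : ∀ x : Fin N → κ, (∏ i, t (x i)) * (Real.exp L * (1 + Y x - L)) ≤
      min 1 (Real.exp (-(N * a)) * ∏ i, w (x i)) * ∏ i, p (x i) := by
    intro x
    have hP : 0 ≤ min 1 (Real.exp (-(N * a)) * ∏ i, w (x i)) * ∏ i, p (x i) :=
      mul_nonneg (le_min zero_le_one (mul_nonneg (Real.exp_pos _).le
        (Finset.prod_nonneg fun i _ => hw _))) (Finset.prod_nonneg fun i _ => hp _)
    by_cases hx : ∏ i, t (x i) = 0
    · rw [hx, zero_mul]; exact hP
    have hxi : ∀ i, t (x i) ≠ 0 := fun i h => hx (Finset.prod_eq_zero (Finset.mem_univ i) h)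
    have htpos : ∀ i, 0 < t (x i) := fun i => lt_of_le_of_ne (ht _) (hxi i).symm
    have e1 : ∏ i, t (x i) = Real.exp (∑ i, Real.log (t (x i))) := by
      rw [Real.exp_sum]; exact Finset.prod_congr rfl fun i _ => (Real.exp_log (htpos i)).symm
    have e2 : ∏ i, p (x i) = Real.exp (∑ i, Real.log (p (x i))) := by
      rw [Real.exp_sum]
      exact Finset.prod_congr rfl fun i _ => (Real.exp_log (htp _ (hxi i))).symm
    have e3 : ∏ i, w (x i) = Real.exp (∑ i, Real.log (w (x i))) := by
      rw [Real.exp_sum]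
      exact Finset.prod_congr rfl fun i _ => (Real.exp_log (htw _ (hxi i))).symm
    have h1 : Real.exp L * (1 + Y x - L) ≤ Real.exp (Y x) := by
      have := Real.add_one_le_exp (Y x - L)
      calc _ ≤ Real.exp L * Real.exp (Y x - L) :=
            mul_le_mul_of_nonneg_left (by linarith) (Real.exp_pos _).le
        _ = _ := by rw [← Real.exp_add]; congr 1; ring
    refine (mul_le_mul_of_nonneg_left h1 (Finset.prod_nonneg fun i _ => ht _)).trans ?_
    have hmin : min 1 (Real.exp (-(N * a)) * ∏ i, w (x i)) =
        Real.exp (min 0 (-(N * a) + ∑ i, Real.log (w (x i)))) := by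
      rw [e3, ← Real.exp_add, ← Real.exp_zero, Real.exp_monotone.map_min]
    rw [hmin, e1, e2, ← Real.exp_add, ← Real.exp_add, Real.exp_le_exp]
    have hsz : ∑ i, z (x i) = ∑ i, Real.log (w (x i)) - N * b := by
      simp [hz, Finset.sum_sub_distrib]
    have hsg : ∑ i, g (x i) = ∑ i, Real.log (t (x i)) - ∑ i, Real.log (p (x i)) := by
      simp [hg, Finset.sum_sub_distrib]
    set S := ∑ i, z (x i) with hS
    have habs : |S| ≤ (S ^ 2 / √N + √N) / 2 := by
      rcases Nat.eq_zero_or_pos N with h | h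
      · subst h; simp [hS]
      · have hs : 0 < √(N : ℝ) := Real.sqrt_pos.mpr (by exact_mod_cast h)
        have h3 : 0 ≤ (|S| - √N) ^ 2 := sq_nonneg _
        have h4 : |S| ^ 2 = S ^ 2 := sq_abs S
        rw [div_add' _ _ _ hs.ne', div_div, le_div_iff₀ (by positivity)]
        nlinarith
    have hlow : -(N * c) - |S| ≤ min 0 (-(N * a) + ∑ i, Real.log (w (x i))) := by
      have hN : (0 : ℝ) ≤ N := Nat.cast_nonneg N
      have hc0 : 0 ≤ c := le_max_right _ _
      have hcab : a - b ≤ c := le_max_left _ _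
      refine le_min ?_ ?_
      · nlinarith [abs_nonneg S, mul_nonneg hN hc0]
      · have : -(N * a) + ∑ i, Real.log (w (x i)) = -(N * (a - b)) + S := by rw [hsz]; ring
        rw [this]
        nlinarith [neg_abs_le S, mul_le_mul_of_nonneg_left hcab hN]
    simp only [hY]
    rw [hsg]
    linarith
  calc Real.exp L = ∑ x : Fin N → κ, (∏ i, t (x i)) * (Real.exp L * (1 + Y x - L)) := by
        have : ∀ x : Fin N → κ, (∏ i, t (x i)) * (Real.exp L * (1 + Y x - L)) =
          Real.exp L * (1 - L) * (∏ i, t (x i)) + Real.exp L * ((∏ i, t (x i)) * Y x) :=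
          fun x => by ring
        simp only [this, Finset.sum_add_distrib, ← Finset.mul_sum, sum_iid_one ht1, hEY]
        ring
    _ ≤ _ := Finset.sum_le_sum fun x _ => hterm x

end Classical

/-- Finite version of the minimax theorem. -/
lemma exists_forall_lt_of_finite {E F : Type*} [AddCommGroup E] [Module ℝ E]
    [AddCommGroup F] [Module ℝ F] {T : Set E} {K : Set F} {f : E → F → ℝ}
    (hTn : T.Nonempty) (hconv : ∀ y ∈ K, ConvexOn ℝ T fun x => f x y)
    (hconc : ∀ x ∈ T, ConcaveOn ℝ K (f x)) {V V' : ℝ} (hV : V < V')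
    (h : ∀ y ∈ K, ∃ x ∈ T, f x y ≤ V) {J : Type*} [Fintype J] (y : J → F) (hy : ∀ j, y j ∈ K) :
    ∃ x ∈ T, ∀ j, f x (y j) < V' := by
  by_contra! hcon
  have hTc : Convex ℝ T := by
    obtain ⟨x, hx⟩ := hTn
    by_cases hJ : Nonempty J
    · exact (hconv _ (hy hJ.some)).1
    · obtain ⟨j, -⟩ := hcon x hx
      exact absurd ⟨j⟩ hJ
  set A : Set (J → ℝ) := {v | ∃ x ∈ T, ∀ j, f x (y j) ≤ v j} with hA
  set B : Set (J → ℝ) := Set.univ.pi fun _ => Set.Iio V' with hB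
  have hAc : Convex ℝ A := by
    rintro v ⟨x, hx, hxv⟩ v' ⟨x', hx', hxv'⟩ a b ha hb hab
    refine ⟨a • x + b • x', hTc hx hx' ha hb hab, fun j => ?_⟩
    refine ((hconv _ (hy j)).2 hx hx' ha hb hab).trans ?_
    simp only [smul_eq_mul, Pi.add_apply, Pi.smul_apply]
    exact add_le_add (mul_le_mul_of_nonneg_left (hxv j) ha)
      (mul_le_mul_of_nonneg_left (hxv' j) hb)
  have hBc : Convex ℝ B := convex_pi fun _ _ => convex_Iio V'
  have hBo : IsOpen B := isOpen_set_pi Set.finite_univ fun _ _ => isOpen_Iio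
  have hdisj : Disjoint B A := by
    rw [Set.disjoint_left]
    rintro v hvB ⟨x, hx, hxv⟩
    obtain ⟨j, hj⟩ := hcon x hx
    have : v j < V' := hvB j (Set.mem_univ j)
    linarith [hxv j]
  obtain ⟨φ, c, hφB, hφA⟩ := geometric_hahn_banach_open hBc hBo hAc hdisj
  set l : J → ℝ := fun j => φ (Pi.single j 1) with hl
  have hφ : ∀ v : J → ℝ, φ v = ∑ j, v j * l j := by
    intro v
    conv_lhs => rw [pi_eq_sum_univ' v]
    rw [map_sum]
    refine Finset.sum_congr rfl fun j _ => ?_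
    rw [map_smul, smul_eq_mul, hl]
  have hl0 : ∀ j, 0 ≤ l j := by
    intro j
    by_contra! hneg
    set e := φ (fun _ => V' - 1) with he
    have hlim : ∀ R : ℝ, 0 ≤ R → e - R * l j < c := by
      intro R hR
      have hm : (fun _ => V' - 1) - R • (Pi.single j 1 : J → ℝ) ∈ B := by
        intro i _
        simp only [Pi.sub_apply, Pi.smul_apply, smul_eq_mul, Set.mem_Iio]
        have : 0 ≤ (Pi.single j 1 : J → ℝ) i := by
          rw [Pi.single_apply]; split_ifs <;> norm_num
        nlinarith [mul_nonneg hR this]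
      have := hφB _ hm
      rwa [map_sub, map_smul, smul_eq_mul] at this
    have h1 := hlim (|c - e| / -l j) (div_nonneg (abs_nonneg _) (by linarith))
    have h2 : |c - e| / -l j * l j = -|c - e| := by
      rw [div_neg, neg_mul, div_mul_cancel₀ _ hneg.ne]
    rw [h2] at h1
    linarith [le_abs_self (c - e)]
  have hBsup : V' * ∑ j, l j ≤ c := by
    have hcl : ∀ ε : ℝ, 0 < ε → (V' - ε) * ∑ j, l j < c := by
      intro ε hε
      have := hφB (fun _ => V' - ε) (fun i _ => by simp [hε])
      rwa [hφ, ← Finset.mul_sum] at this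
    have ht : Tendsto (fun ε : ℝ => (V' - ε) * ∑ j, l j) (nhdsWithin 0 (Set.Ioi 0))
        (nhds ((V' - 0) * ∑ j, l j)) :=
      ((by fun_prop : Continuous fun ε : ℝ => (V' - ε) * ∑ j, l j).tendsto 0).mono_left
        nhdsWithin_le_nhds
    rw [sub_zero] at ht
    refine le_of_tendsto ht ?_
    filter_upwards [self_mem_nhdsWithin] with ε hε using (hcl ε hε).le
  have hΛ : 0 < ∑ j, l j := by
    refine lt_of_le_of_ne (Finset.sum_nonneg fun j _ => hl0 j) fun h0 => ?_
    have hz : ∀ j, l j = 0 := fun j =>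
      (Finset.sum_eq_zero_iff_of_nonneg fun j _ => hl0 j).mp h0.symm j (Finset.mem_univ j)
    obtain ⟨x, hx⟩ := hTn
    have h1 := hφA (fun j => f x (y j)) ⟨x, hx, fun j => le_rfl⟩
    have h2 := hφB (fun _ => V' - 1) (fun i _ => by simp)
    rw [hφ] at h1 h2
    simp only [hz, mul_zero, Finset.sum_const_zero] at h1 h2
    linarith
  set Λ := ∑ j, l j with hΛd
  have hwt : ∑ j, l j / Λ = 1 := by rw [← Finset.sum_div, div_self hΛ.ne']
  obtain ⟨j0⟩ : Nonempty J := by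
    by_contra hJ
    rw [not_nonempty_iff] at hJ
    simp [hΛd] at hΛ
  have hKc : Convex ℝ K := by
    obtain ⟨x, hx⟩ := hTn
    exact (hconc x hx).1
  have hbar : ∑ j, (l j / Λ) • y j ∈ K :=
    hKc.sum_mem (fun j _ => div_nonneg (hl0 j) hΛ.le) hwt fun j _ => hy j
  obtain ⟨x, hx, hxV⟩ := h _ hbar
  have h1 := (hconc x hx).le_map_sum (t := Finset.univ)
    (fun j _ => div_nonneg (hl0 j) hΛ.le) hwt (fun j _ => hy j)
  have h2 := hφA (fun j => f x (y j)) ⟨x, hx, fun j => le_rfl⟩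
  rw [hφ] at h2
  have h3 : ∑ j, (l j / Λ) • f x (y j) = (∑ j, f x (y j) * l j) / Λ := by
    rw [Finset.sum_div]
    refine Finset.sum_congr rfl fun j _ => ?_
    rw [smul_eq_mul]; ring
  rw [h3] at h1
  have h4 : (∑ j, f x (y j) * l j) ≤ V * Λ := (div_le_iff₀ hΛ).mp (h1.trans hxV)
  nlinarith

/-- Minimax theorem for a function that is convex and continuous on a compact set in the first
variable, and concave in the second one. -/
lemma exists_forall_le_of_minimax {E F : Type*} [AddCommGroup E] [Module ℝ E]
    [TopologicalSpace E] [T2Space E]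
    [AddCommGroup F] [Module ℝ F] {T : Set E} {K : Set F} {f : E → F → ℝ}
    (hTn : T.Nonempty) (hTk : IsCompact T) (hcont : ∀ y ∈ K, ContinuousOn (fun x => f x y) T)
    (hconv : ∀ y ∈ K, ConvexOn ℝ T fun x => f x y)
    (hconc : ∀ x ∈ T, ConcaveOn ℝ K (f x)) {V : ℝ}
    (h : ∀ y ∈ K, ∃ x ∈ T, f x y ≤ V) : ∃ x ∈ T, ∀ y ∈ K, f x y ≤ V := by
  set C : K × Set.Ioi V → Set E := fun j => T ∩ (fun x => f x j.1) ⁻¹' Set.Iic (j.2 : ℝ) with hC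
  have hclosed : ∀ j, IsClosed (C j) := fun j =>
    (hcont _ j.1.2).preimage_isClosed_of_isClosed hTk.isClosed isClosed_Iic
  have hne : (T ∩ ⋂ j, C j).Nonempty := by
    refine hTk.inter_iInter_nonempty C hclosed fun u => ?_
    obtain ⟨V', hV', hu⟩ : ∃ V' : ℝ, V < V' ∧ ∀ j ∈ u, V' ≤ (j.2 : ℝ) := by
      induction u using Finset.induction_on with
      | empty => exact ⟨V + 1, by linarith, by simp⟩
      | insert j u _ ih =>
        obtain ⟨V', h1, h2⟩ := ih
        refine ⟨min V' j.2, lt_min h1 j.2.2, fun i hi => ?_⟩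
        rcases Finset.mem_insert.mp hi with rfl | hi
        · exact min_le_right _ _
        · exact (min_le_left _ _).trans (h2 i hi)
    obtain ⟨x, hx, hxj⟩ := exists_forall_lt_of_finite hTn hconv hconc hV' h
      (fun j : u => ((j : K × Set.Ioi V).1 : F)) (fun j => j.1.1.2)
    refine ⟨x, hx, ?_⟩
    simp only [Set.mem_iInter]
    intro j hj
    exact ⟨hx, (hxj ⟨j, hj⟩).le.trans (hu j hj)⟩
  obtain ⟨x, hx, hxC⟩ := hne
  refine ⟨x, hx, fun y hy => ?_⟩
  refine le_of_forall_gt_imp_ge_of_dense fun V' hV' => ?_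
  exact (Set.mem_iInter.mp hxC (⟨y, hy⟩, ⟨V', hV'⟩)).2

section Classical

variable {κ : Type*} [Fintype κ]

lemma le_of_continuousAt_zero {g : ℝ → ℝ} {V : ℝ} (hg : ContinuousAt g 0)
    (h : ∀ η, 0 < η → η < 1 → g η ≤ V) : g 0 ≤ V := by
  refine le_of_tendsto (hg.tendsto.mono_left nhdsWithin_le_nhds : Tendsto g (nhdsWithin 0 (Ioi 0)) _) ?_
  filter_upwards [Ioo_mem_nhdsGT (show (0 : ℝ) < 1 by norm_num)] with η hη using h η hη.1 hη.2

/-- Existence of a single distribution that is near-optimal for all Hoeffding parameters at once,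
obtained from the minimax theorem. -/
lemma exists_distribution_forall_le {p : κ → ℝ} (hp : ∀ i, 0 ≤ p i) (hp1 : ∑ i, p i = 1)
    {Q : Set (κ → ℝ)} (hQc : Convex ℝ Q) (a V : ℝ)
    (h : ∀ s, 0 < s → s < 1 → ∀ q ∈ Q, (∀ i, 0 < p i → 0 < q i) →
      s * a - (1 - s) * Real.log (∑ i, p i ^ (1 / (1 - s)) * q i ^ (1 - 1 / (1 - s))) ≤ V) :
    ∃ t : κ → ℝ, (∀ i, 0 ≤ t i) ∧ ∑ i, t i = 1 ∧ (∀ i, p i = 0 → t i = 0) ∧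
      ∀ s, 0 < s → s < 1 → ∀ q ∈ Q, (∀ i, 0 < p i → 0 < q i) →
        ∑ i, t i * (Real.log (t i) - Real.log (p i)) +
          s * (a - ∑ i, t i * (Real.log (t i) - Real.log (q i))) ≤ V := by
  set T : Set (κ → ℝ) := stdSimplex ℝ κ ∩ {t | ∀ i, p i = 0 → t i = 0} with hT
  set K : Set (ℝ × (κ → ℝ)) := {y | 0 < y.1 ∧ y.1 < 1 ∧ ∃ q ∈ Q, (∀ i, 0 < p i → 0 < q i) ∧
    ∀ i, 0 < p i → y.2 i ≤ y.1 * Real.log (q i)} with hK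
  set f : (κ → ℝ) → ℝ × (κ → ℝ) → ℝ := fun t y =>
    ∑ i, ((1 - y.1) * (t i * Real.log (t i)) + t i * (y.2 i - Real.log (p i))) + y.1 * a with hf
  have hTclosed : IsClosed {t : κ → ℝ | ∀ i, p i = 0 → t i = 0} := by
    simp only [Set.ofPred_forall]
    exact isClosed_iInter fun i => isClosed_iInter fun _ =>
      isClosed_eq (continuous_apply i) continuous_const
  have hTconv : Convex ℝ {t : κ → ℝ | ∀ i, p i = 0 → t i = 0} := by
    intro x hx y hy b c _ _ _ i hi
    simp [hx i hi, hy i hi]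
  have hTk : IsCompact T := (isCompact_stdSimplex ℝ κ).inter_right hTclosed
  have hTc : Convex ℝ T := (convex_stdSimplex ℝ κ).inter hTconv
  have hpT : p ∈ T := ⟨⟨hp, hp1⟩, fun i hi => hi⟩
  obtain ⟨t, ht, htK⟩ := exists_forall_le_of_minimax (f := f) (K := K) (V := V) ⟨p, hpT⟩ hTk
    (fun y _ => by
      refine Continuous.continuousOn ?_
      refine (continuous_finsetSum _ fun i _ => ?_).add continuous_const
      exact (continuous_const.mul (Real.continuous_mul_log.comp (continuous_apply i))).add
        ((continuous_apply i).mul continuous_const))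
    (fun y hy => by
      refine ⟨hTc, fun x hx z hz b c hb hc hbc => ?_⟩
      simp only [hf, smul_eq_mul, Pi.add_apply, Pi.smul_apply]
      have h1 : ∀ i, (b * x i + c * z i) * Real.log (b * x i + c * z i) ≤
          b * (x i * Real.log (x i)) + c * (z i * Real.log (z i)) := fun i =>
        Real.convexOn_mul_log.2 (hx.1.1 i) (hz.1.1 i) hb hc hbc
      have h2 : ∑ i, ((1 - y.1) * ((b * x i + c * z i) * Real.log (b * x i + c * z i)) +
          (b * x i + c * z i) * (y.2 i - Real.log (p i))) ≤
          b * ∑ i, ((1 - y.1) * (x i * Real.log (x i)) + x i * (y.2 i - Real.log (p i))) +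
            c * ∑ i, ((1 - y.1) * (z i * Real.log (z i)) + z i * (y.2 i - Real.log (p i))) := by
        rw [Finset.mul_sum, Finset.mul_sum, ← Finset.sum_add_distrib]
        refine Finset.sum_le_sum fun i _ => ?_
        have := mul_le_mul_of_nonneg_left (h1 i) (show 0 ≤ 1 - y.1 by linarith [hy.2.1])
        linarith
      have h3 : y.1 * a = b * (y.1 * a) + c * (y.1 * a) := by rw [← add_mul, hbc, one_mul]
      linarith)
    (fun t _ => by
      refine ⟨?_, fun x _ z _ b c _ _ hbc => le_of_eq ?_⟩
      · rintro x ⟨hx0, hx1, q, hq, hqp, hxq⟩ z ⟨hz0, hz1, q', hq', hqp', hzq'⟩ b c hb hc hbc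
        have hs : 0 < b * x.1 + c * z.1 := by
          rcases hb.lt_or_eq with hb' | rfl
          · have := mul_pos hb' hx0; have := mul_nonneg hc hz0.le; linarith
          · have : c = 1 := by linarith
            subst this; linarith
        have hs0 := hs.ne'
        have e1 : 0 ≤ b * x.1 / (b * x.1 + c * z.1) := by positivity
        have e2 : 0 ≤ c * z.1 / (b * x.1 + c * z.1) := by positivity
        have e3 : b * x.1 / (b * x.1 + c * z.1) + c * z.1 / (b * x.1 + c * z.1) = 1 := by
          rw [← add_div, div_self hs0]
        refine ⟨hs, ?_, (b * x.1 / (b * x.1 + c * z.1)) • q + (c * z.1 / (b * x.1 + c * z.1)) • q',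
          hQc hq hq' e1 e2 e3, fun i hi => ?_, fun i hi => ?_⟩
        · have h1 : 0 ≤ b * (1 - x.1) := mul_nonneg hb (by linarith)
          have h2 : 0 ≤ c * (1 - z.1) := mul_nonneg hc (by linarith)
          rcases hb.lt_or_eq with hb' | rfl
          · have : 0 < b * (1 - x.1) := mul_pos hb' (by linarith)
            show b * x.1 + c * z.1 < 1
            nlinarith
          · have : c = 1 := by linarith
            subst this; show 0 * x.1 + 1 * z.1 < 1; linarith
        · exact (convex_Ioi (0 : ℝ)) (hqp i hi) (hqp' i hi) e1 e2 e3
        · have hl := strictConcaveOn_log_Ioi.concaveOn.2 (hqp i hi) (hqp' i hi) e1 e2 e3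
          simp only [smul_eq_mul, Pi.add_apply, Pi.smul_apply, Prod.snd_add, Prod.smul_snd,
            Prod.fst_add, Prod.smul_fst] at hl ⊢
          have hl' := mul_le_mul_of_nonneg_left hl hs.le
          have e4 : (b * x.1 + c * z.1) * (b * x.1 / (b * x.1 + c * z.1) * Real.log (q i) +
              c * z.1 / (b * x.1 + c * z.1) * Real.log (q' i)) =
              b * (x.1 * Real.log (q i)) + c * (z.1 * Real.log (q' i)) := by
            field_simp
          rw [e4] at hl'
          have := mul_le_mul_of_nonneg_left (hxq i hi) hb
          have := mul_le_mul_of_nonneg_left (hzq' i hi) hc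
          linarith
      · simp only [hf, smul_eq_mul, Pi.add_apply, Pi.smul_apply, Prod.snd_add, Prod.smul_snd,
            Prod.fst_add, Prod.smul_fst]
        rw [mul_add, mul_add, add_add_add_comm, Finset.mul_sum, Finset.mul_sum,
          ← Finset.sum_add_distrib]
        congr 1
        · refine Finset.sum_congr rfl fun i _ => ?_
          obtain rfl : b = 1 - c := by linarith
          ring
        · ring)
    (by
      rintro ⟨s, u⟩ ⟨hs0, hs1, q, hq, hqp, hu⟩
      dsimp only at hs0 hs1 hu
      have h1s : 0 < 1 - s := by linarith
      set α := 1 / (1 - s) with hα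
      have hα1 : (1 - s) * α = 1 := by rw [hα]; field_simp
      have hαpos : 0 < α := by positivity
      set R : κ → ℝ := fun i => p i ^ α * q i ^ (1 - α) with hR
      have hR0 : ∀ i, p i = 0 → R i = 0 := fun i hi => by
        simp [hR, hi, Real.zero_rpow hαpos.ne']
      have hRp : ∀ i, 0 < p i → 0 < R i := fun i hi =>
        mul_pos (Real.rpow_pos_of_pos hi _) (Real.rpow_pos_of_pos (hqp i hi) _)
      have hRn : ∀ i, 0 ≤ R i := fun i => by
        rcases (hp i).lt_or_eq with hi | hi
        · exact (hRp i hi).le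
        · rw [hR0 i hi.symm]
      set Z := ∑ i, R i with hZ
      have hZpos : 0 < Z := by
        obtain ⟨i, -, hi⟩ : ∃ i ∈ Finset.univ, 0 < p i := by
          by_contra! hcon
          have := Finset.sum_nonpos hcon
          linarith
        exact Finset.sum_pos' (fun i _ => hRn i) ⟨i, Finset.mem_univ i, hRp i hi⟩
      have hmem : (fun i => R i / Z) ∈ T := by
        refine ⟨⟨fun i => div_nonneg (hRn i) hZpos.le, ?_⟩, fun i hi => by simp [hR0 i hi]⟩
        rw [← Finset.sum_div, ← hZ, div_self hZpos.ne']
      refine ⟨_, hmem, ?_⟩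
      refine le_trans ?_ (h s hs0 hs1 q hq hqp)
      have hterm : ∀ i, (1 - s) * (R i / Z * Real.log (R i / Z)) + R i / Z * (u i - Real.log (p i))
          ≤ R i / Z * (-((1 - s) * Real.log Z)) := by
        intro i
        rcases (hp i).lt_or_eq with hi | hi
        · have hl : Real.log (R i / Z) = α * Real.log (p i) + (1 - α) * Real.log (q i)
              - Real.log Z := by
            rw [Real.log_div (hRp i hi).ne' hZpos.ne', hR,
              Real.log_mul (Real.rpow_pos_of_pos hi _).ne'
                (Real.rpow_pos_of_pos (hqp i hi) _).ne', Real.log_rpow hi,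
              Real.log_rpow (hqp i hi)]
          have hl2 : (1 - s) * Real.log (R i / Z) = Real.log (p i) - s * Real.log (q i)
              - (1 - s) * Real.log Z := by
            rw [hl]
            linear_combination (Real.log (p i) - Real.log (q i)) * hα1
          have h3 : 0 ≤ R i / Z := div_nonneg (hRn i) hZpos.le
          have := mul_le_mul_of_nonneg_left (hu i hi) h3
          have h4 : (1 - s) * (R i / Z * Real.log (R i / Z)) =
            R i / Z * (Real.log (p i) - s * Real.log (q i) - (1 - s) * Real.log Z) := by
            rw [← hl2]; ring
          rw [h4]; linarith
        · simp [hR0 i hi.symm]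
      have hsum := Finset.sum_le_sum fun i (_ : i ∈ Finset.univ) => hterm i
      rw [← Finset.sum_mul, ← Finset.sum_div, ← hZ, div_self hZpos.ne', one_mul] at hsum
      simp only [hf]
      linarith)
  refine ⟨t, ht.1.1, ht.1.2, ht.2, fun s hs0 hs1 q hq hqp => ?_⟩
  refine le_trans (le_of_eq ?_)
    (htK (s, fun i => s * Real.log (q i)) ⟨hs0, hs1, q, hq, hqp, fun i _ => le_rfl⟩)
  simp only [hf]
  rw [mul_sub, Finset.mul_sum, add_sub_assoc', add_sub_right_comm, ← Finset.sum_sub_distrib]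
  congr 1
  exact Finset.sum_congr rfl fun i _ => by ring

/-- The optimal distribution together with a weight in the polar of the alternative set. -/
lemma exists_distribution_weight {p : κ → ℝ} (hp : ∀ i, 0 ≤ p i) (hp1 : ∑ i, p i = 1)
    {Q : Set (κ → ℝ)} (hQc : Convex ℝ Q) (hQk : IsCompact Q) (hQ0 : ∀ q ∈ Q, ∀ i, 0 ≤ q i)
    {q₀ : κ → ℝ} (hq₀ : q₀ ∈ Q) (hq₀p : ∀ i, 0 < p i → 0 < q₀ i) (a V : ℝ)
    (h : ∀ s, 0 < s → s < 1 → ∀ q ∈ Q, (∀ i, 0 < p i → 0 < q i) →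
      s * a - (1 - s) * Real.log (∑ i, p i ^ (1 / (1 - s)) * q i ^ (1 - 1 / (1 - s))) ≤ V) :
    ∃ t w : κ → ℝ, (∀ i, 0 ≤ t i) ∧ (∀ i, 0 ≤ w i) ∧ ∑ i, t i = 1 ∧ (∀ i, t i ≠ 0 → 0 < p i) ∧
      (∀ i, t i ≠ 0 → 0 < w i) ∧ (∀ q ∈ Q, ∑ i, w i * q i ≤ 1) ∧
      ∑ i, t i * (Real.log (t i) - Real.log (p i)) +
        max (a - ∑ i, t i * Real.log (w i)) 0 ≤ V := by
  obtain ⟨t, ht0, ht1, htp, htV⟩ := exists_distribution_forall_le hp hp1 hQc a V h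
  have htp' : ∀ i, t i ≠ 0 → 0 < p i := fun i hi =>
    (hp i).lt_of_ne fun h0 => hi (htp i h0.symm)
  set D := ∑ i, t i * (Real.log (t i) - Real.log (p i)) with hD
  have hDV : D ≤ V := by
    have := le_of_continuousAt_zero
      (g := fun η => D + η * (a - ∑ i, t i * (Real.log (t i) - Real.log (q₀ i)))) (by fun_prop)
      fun η h0 h1 => htV η h0 h1 q₀ hq₀ hq₀p
    simpa using this
  have hXV : ∀ q ∈ Q, (∀ i, 0 < p i → 0 < q i) →
      D + (a - ∑ i, t i * (Real.log (t i) - Real.log (q i))) ≤ V := by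
    intro q hq hqp
    have := le_of_continuousAt_zero
      (g := fun η => D + (1 - η) * (a - ∑ i, t i * (Real.log (t i) - Real.log (q i))))
      (by fun_prop) fun η h0 h1 => htV (1 - η) (by linarith) (by linarith) q hq hqp
    simpa using this
  obtain ⟨q, hq, hqmax⟩ := hQk.exists_isMaxOn ⟨q₀, hq₀⟩
    (f := fun q : κ → ℝ => ∏ i, q i ^ t i)
    (continuous_finsetProd _ fun i _ =>
      (continuous_apply i).rpow_const fun _ => Or.inr (ht0 i)).continuousOn
  have hprod : ∀ x ∈ Q, (∀ i, t i ≠ 0 → 0 < x i) → 0 < ∏ i, x i ^ t i := by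
    intro x hx hxt
    refine Finset.prod_pos fun i _ => ?_
    by_cases hi : t i = 0
    · simp [hi]
    · exact Real.rpow_pos_of_pos (hxt i hi) _
  have hqpos : ∀ i, t i ≠ 0 → 0 < q i := by
    intro i hi
    refine (hQ0 q hq i).lt_of_ne fun h0 => ?_
    have h1 := hprod q₀ hq₀ fun j hj => hq₀p j (htp' j hj)
    have h2 : ∏ i, q₀ i ^ t i ≤ ∏ i, q i ^ t i := hqmax hq₀
    rw [Finset.prod_eq_zero (f := fun i => q i ^ t i) (Finset.mem_univ i)
      (by rw [← h0, Real.zero_rpow hi])] at h2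
    linarith
  have hlog : ∀ x ∈ Q, (∀ i, t i ≠ 0 → 0 < x i) →
      Real.log (∏ i, x i ^ t i) = ∑ i, t i * Real.log (x i) := by
    intro x hx hxt
    rw [Real.log_prod]
    · refine Finset.sum_congr rfl fun i _ => ?_
      by_cases hi : t i = 0
      · simp [hi]
      · rw [Real.log_rpow (hxt i hi)]
    · intro i _
      by_cases hi : t i = 0
      · simp [hi]
      · exact (Real.rpow_pos_of_pos (hxt i hi) _).ne'
  have hseg : ∀ x ∈ Q, ∀ η : ℝ, 0 < η → η < 1 → (fun i => (1 - η) * q i + η * x i) ∈ Q :=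
    fun x hx η h0 h1 => hQc hq hx (by linarith) h0.le (by ring)
  have hsegpos : ∀ x ∈ Q, ∀ η : ℝ, 0 < η → η < 1 → ∀ i, t i ≠ 0 →
      0 < (1 - η) * q i + η * x i := fun x hx η h0 h1 i hi => by
    have := mul_pos (show 0 < 1 - η by linarith) (hqpos i hi)
    have := mul_nonneg h0.le (hQ0 x hx i)
    linarith
  refine ⟨t, fun i => t i / q i, ht0, fun i => div_nonneg (ht0 i) (hQ0 q hq i), ht1, htp',
    fun i hi => div_pos ((ht0 i).lt_of_ne' hi) (hqpos i hi), fun x hx => ?_, ?_⟩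
  · have hder := le_of_continuousAt_zero (V := 0)
      (g := fun η => ∑ i, t i * ((x i - q i) / ((1 - η) * q i + η * x i))) (by
        refine tendsto_finsetSum _ fun i _ => ?_
        by_cases hi : t i = 0
        · simp [hi]
        · refine (ContinuousAt.mul continuousAt_const (ContinuousAt.div continuousAt_const
            (by fun_prop) ?_)).tendsto
          simpa using (hqpos i hi).ne') (by
        intro η h0 h1
        have hm : ∏ i, ((1 - η) * q i + η * x i) ^ t i ≤ ∏ i, q i ^ t i :=
          hqmax (hseg x hx η h0 h1)
        have hm2 := Real.log_le_log (hprod _ (hseg x hx η h0 h1) (hsegpos x hx η h0 h1)) hm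
        rw [hlog _ (hseg x hx η h0 h1) (hsegpos x hx η h0 h1), hlog q hq hqpos] at hm2
        have hm3 : ∑ i, t i * (η * ((x i - q i) / ((1 - η) * q i + η * x i))) ≤
            ∑ i, (t i * Real.log ((1 - η) * q i + η * x i) - t i * Real.log (q i)) := by
          refine Finset.sum_le_sum fun i _ => ?_
          by_cases hi : t i = 0
          · simp [hi]
          · rw [← mul_sub]
            refine mul_le_mul_of_nonneg_left ?_ (ht0 i)
            have hy := hsegpos x hx η h0 h1 i hi
            rw [← Real.log_div hy.ne' (hqpos i hi).ne']
            have := Real.one_sub_inv_le_log_of_pos (div_pos hy (hqpos i hi))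
            refine le_trans (le_of_eq ?_) this
            rw [inv_div, eq_sub_iff_add_eq, mul_div_assoc', ← add_div, div_eq_one_iff_eq hy.ne']
            ring
        rw [Finset.sum_sub_distrib] at hm3
        have hm4 : η * ∑ i, t i * ((x i - q i) / ((1 - η) * q i + η * x i)) ≤ 0 := by
          rw [Finset.mul_sum]
          refine le_trans (le_of_eq (Finset.sum_congr rfl fun i _ => ?_)) (hm3.trans (by linarith))
          ring
        exact nonpos_of_mul_nonpos_right hm4 h0)
    have e : ∑ i, t i / q i * x i = ∑ i, t i * ((x i - q i) / q i) + ∑ i, t i := by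
      rw [← Finset.sum_add_distrib]
      refine Finset.sum_congr rfl fun i _ => ?_
      by_cases hi : t i = 0
      · simp [hi]
      · have := (hqpos i hi).ne'
        field_simp; ring
    simp only [sub_zero, one_mul, zero_mul, add_zero] at hder
    rw [e, ht1]; linarith
  · have hder := le_of_continuousAt_zero (V := V)
      (g := fun η => D + (a - ∑ i, t i * (Real.log (t i) - Real.log ((1 - η) * q i + η * q₀ i))))
      (by
        refine ContinuousAt.add continuousAt_const (ContinuousAt.sub continuousAt_const ?_)
        refine tendsto_finsetSum _ fun i _ => ?_
        by_cases hi : t i = 0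
        · simp [hi]
        · refine (ContinuousAt.mul continuousAt_const (ContinuousAt.sub continuousAt_const
            (ContinuousAt.log (by fun_prop) ?_))).tendsto
          simpa using (hqpos i hi).ne')
      (fun η h0 h1 => hXV _ (hseg q₀ hq₀ η h0 h1) fun i hi => by
        have := mul_pos h0 (hq₀p i hi)
        have := mul_nonneg (show 0 ≤ 1 - η by linarith) (hQ0 q hq i)
        linarith)
    have e : ∑ i, t i * Real.log (t i / q i) = ∑ i, t i * (Real.log (t i) - Real.log (q i)) := by
      refine Finset.sum_congr rfl fun i _ => ?_
      by_cases hi : t i = 0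
      · simp [hi]
      · rw [Real.log_div hi (hqpos i hi).ne']
    simp only [sub_zero, one_mul, zero_mul, add_zero] at hder
    rw [e]
    rcases max_cases (a - ∑ i, t i * (Real.log (t i) - Real.log (q i))) 0 with h' | h'
    · rw [h'.1]; exact hder
    · rw [h'.1]; linarith

end Classical

lemma rate_of_nonpos {n : ℕ} (hn : 1 ≤ n) {x : ℝ} (hx : x ≤ 0) : rate n x = ⊤ := by
  have : (0 : ℝ) < (n : ℝ)⁻¹ := by positivity
  rw [rate, negLog, if_pos hx, EReal.coe_mul_top_of_pos this]

lemma rate_of_pos {n : ℕ} {x : ℝ} (hx : 0 < x) :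
    rate n x = (((n : ℝ)⁻¹ * -Real.log x : ℝ) : EReal) := by
  rw [rate, negLog, if_neg hx.not_ge, ← EReal.coe_mul]

/-- A real lower bound `c ≤ -(1/n) log x` follows from `x ≤ exp (-n c)`. -/
lemma le_rate_of_le_exp {n : ℕ} (hn : 1 ≤ n) {x c : ℝ} (h : x ≤ Real.exp (-(n * c))) :
    (c : EReal) ≤ rate n x := by
  have hn' : (0 : ℝ) < n := by exact_mod_cast hn
  rcases le_or_gt x 0 with hx | hx
  · rw [rate_of_nonpos hn hx]; exact le_top
  · rw [rate_of_pos hx, EReal.coe_le_coe_iff, inv_mul_eq_div, le_div_iff₀ hn']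
    have := Real.log_le_log hx h
    rw [Real.log_exp] at this
    linarith

lemma rate_le_of_exp_le {n : ℕ} (hn : 1 ≤ n) {x c : ℝ} (h : Real.exp (-(n * c)) ≤ x) :
    rate n x ≤ (c : EReal) := by
  have hn' : (0 : ℝ) < n := by exact_mod_cast hn
  have hx := (Real.exp_pos _).trans_le h
  rw [rate_of_pos hx, EReal.coe_le_coe_iff, inv_mul_eq_div, div_le_iff₀ hn']
  have := Real.log_le_log (Real.exp_pos _) h
  rw [Real.log_exp] at this
  linarith

lemma le_exp_of_lt_rate {n : ℕ} (hn : 1 ≤ n) {x c : ℝ} (h : (c : EReal) < rate n x) :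
    x ≤ Real.exp (-(n * c)) := by
  by_contra! hcon
  exact absurd h (rate_le_of_exp_le hn hcon.le).not_gt

lemma tendsto_inv_mul_of_abs_sub_le {x : ℕ → ℝ} {l K : ℝ}
    (h : ∀ n : ℕ, 1 ≤ n → |x n - n * l| ≤ K) :
    Tendsto (fun n : ℕ => (n : ℝ)⁻¹ * x n) atTop (nhds l) := by
  rw [tendsto_iff_norm_sub_tendsto_zero]
  have hK : Tendsto (fun n : ℕ => (n : ℝ)⁻¹ * K) atTop (nhds 0) := by
    simpa using (tendsto_inv_atTop_nhds_zero_nat (𝕜 := ℝ)).mul_const K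
  refine squeeze_zero' (Eventually.of_forall fun n => norm_nonneg _) ?_ hK
  filter_upwards [eventually_ge_atTop 1] with n hn
  have hn' : (0 : ℝ) < n := by exact_mod_cast hn
  have e : (n : ℝ)⁻¹ * x n - l = (n : ℝ)⁻¹ * (x n - n * l) := by field_simp
  rw [e, Real.norm_eq_abs, abs_mul, abs_of_pos (inv_pos.mpr hn')]
  exact mul_le_mul_of_nonneg_left (h n hn) (inv_pos.mpr hn').le

/-- Division with remainder in the range `1, …, m`. -/
lemma exists_eq_add_mul {m n : ℕ} (hm : 1 ≤ m) (hn : 1 ≤ n) :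
    ∃ s N : ℕ, n = s + N * m ∧ 1 ≤ s ∧ s ≤ m := by
  refine ⟨(n - 1) % m + 1, (n - 1) / m, ?_, by omega, Nat.mod_lt _ hm⟩
  have := Nat.mod_add_div (n - 1) m
  rw [mul_comm m] at this
  omega

section Family

variable {d : ℕ} {ρ : Matrix (Fin d) (Fin d) ℂ}
  {S : (n : ℕ) → Set (Matrix (Fin n → Fin d) (Fin n → Fin d) ℂ)}

/-- The value `x` is attained as `log Q̃_α(ρ^{⊗n}‖σ)` for some `σ ∈ S n` whose support
contains that of `ρ^{⊗n}`. -/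
def AttainsLogQ (α : ℝ) (ρ : Matrix (Fin d) (Fin d) ℂ)
    (S : (n : ℕ) → Set (Matrix (Fin n → Fin d) (Fin n → Fin d) ℂ)) (n : ℕ) (x : ℝ) : Prop :=
  ∃ σ ∈ S n, msupp (tpow ρ n) ≤ msupp σ ∧ Real.log (Qsand α (tpow ρ n) σ) = x

lemma AttainsLogQ.add (hρ : IsState ρ) (hS : Assumption1 S) {α : ℝ} (hα : 1 < α) {m n : ℕ}
    (hm : 1 ≤ m) (hn : 1 ≤ n) {x y : ℝ} (hx : AttainsLogQ α ρ S m x)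
    (hy : AttainsLogQ α ρ S n y) : AttainsLogQ α ρ S (m + n) (x + y) := by
  obtain ⟨σ, hσ, hσs, rfl⟩ := hx
  obtain ⟨τ, hτ, hτs, rfl⟩ := hy
  have hσp := hS.psd m hm σ hσ
  have hτp := hS.psd n hn τ hτ
  refine ⟨tensOp σ τ, hS.tens m n hm hn σ hσ τ hτ, ?_, ?_⟩
  · rw [tpow_add]; exact msupp_tensOp_le hσs hτs
  · rw [tpow_add, Qsand_tensOp (tpow_posSemidef hρ.1 m) hσp (tpow_posSemidef hρ.1 n) hτp,
      Real.log_mul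
        (Qsand_pos (tpow_posSemidef hρ.1 m) (rtr_tpow hρ.2 m) hσp hσs hα).ne'
        (Qsand_pos (tpow_posSemidef hρ.1 n) (rtr_tpow hρ.2 n) hτp hτs hα).ne']

lemma AttainsLogQ.nsmul (hρ : IsState ρ) (hS : Assumption1 S) {α : ℝ} (hα : 1 < α) {y : ℝ}
    (hy : AttainsLogQ α ρ S 1 y) {s : ℕ} (hs : 1 ≤ s) : AttainsLogQ α ρ S s (s * y) := by
  induction s, hs using Nat.le_induction with
  | base => simpa using hy
  | succ s hs ih =>
    have := ih.add hρ hS hα hs le_rfl hy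
    push_cast
    rwa [add_mul, one_mul]

lemma AttainsLogQ.add_mul (hρ : IsState ρ) (hS : Assumption1 S) {α : ℝ} (hα : 1 < α) {m s : ℕ}
    (hm : 1 ≤ m) (hs : 1 ≤ s) {x y : ℝ} (hx : AttainsLogQ α ρ S m x)
    (hy : AttainsLogQ α ρ S s y) (N : ℕ) : AttainsLogQ α ρ S (s + N * m) (y + N * x) := by
  induction N with
  | zero => simpa using hy
  | succ N ih =>
    have := ih.add hρ hS hα (by omega) hm hx
    convert this using 1
    · ring
    · push_cast; ring

lemma exists_attainsLogQ_tendsto (hρ : IsState ρ) (hS : Assumption1 S)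
    (hsupp : ∃ τ ∈ S 1, IsState τ ∧ msupp (tpow ρ 1) ≤ msupp τ) {α : ℝ} (hα : 1 < α) {m : ℕ}
    (hm : 1 ≤ m) {x : ℝ} (hx : AttainsLogQ α ρ S m x) :
    ∃ u : ℕ → ℝ, (∀ n, 1 ≤ n → AttainsLogQ α ρ S n (u n)) ∧
      Tendsto (fun n : ℕ => (n : ℝ)⁻¹ * u n) atTop (nhds ((m : ℝ)⁻¹ * x)) := by
  obtain ⟨τ, hτ, -, hτs⟩ := hsupp
  set y := Real.log (Qsand α (tpow ρ 1) τ) with hy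
  have hy1 : AttainsLogQ α ρ S 1 y := ⟨τ, hτ, hτs, rfl⟩
  have hm' : (0 : ℝ) < m := by exact_mod_cast hm
  set l := (m : ℝ)⁻¹ * x with hl
  have key : ∀ n : ℕ, ∃ u : ℝ, 1 ≤ n → AttainsLogQ α ρ S n u ∧ |u - n * l| ≤ m * |y - l| := by
    intro n
    by_cases hn : 1 ≤ n
    · obtain ⟨s, N, rfl, hs1, hsm⟩ := exists_eq_add_mul hm hn
      refine ⟨s * y + N * x, fun _ => ⟨hx.add_mul hρ hS hα hm hs1 (hy1.nsmul hρ hS hα hs1) N, ?_⟩⟩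
      have e : (s * y + N * x) - ((s + N * m : ℕ) : ℝ) * l = s * (y - l) := by
        rw [hl]; push_cast; field_simp; ring
      rw [e, abs_mul, Nat.abs_cast]
      exact mul_le_mul_of_nonneg_right (by exact_mod_cast hsm) (abs_nonneg _)
    · exact ⟨0, fun h => absurd h hn⟩
  choose u hu using key
  exact ⟨u, fun n hn => (hu n hn).1, tendsto_inv_mul_of_abs_sub_le fun n hn => (hu n hn).2⟩

end Family

lemma Dsand_of_msupp_le {ρ σ : Matrix ι ι ℂ} (h : msupp ρ ≤ msupp σ) (α : ℝ) :
    Dsand α ρ σ = (((α - 1)⁻¹ * Real.log (Qsand α ρ σ) : ℝ) : EReal) := if_pos (Or.inr h)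

lemma Dsand_of_not_msupp_le {ρ σ : Matrix ι ι ℂ} (h : ¬ msupp ρ ≤ msupp σ) {α : ℝ}
    (hα : 1 ≤ α) : Dsand α ρ σ = ⊤ :=
  if_neg (not_or.mpr ⟨fun h' => absurd h'.1 hα.not_gt, h⟩)

section Family

variable {d : ℕ} {ρ : Matrix (Fin d) (Fin d) ℂ}
  {S : (n : ℕ) → Set (Matrix (Fin n → Fin d) (Fin n → Fin d) ℂ)}

/-- The regularised Hoeffding anti-divergence, written as a supremum. -/
def antiDivSup (r : ℝ) (ρ : Matrix (Fin d) (Fin d) ℂ)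
    (S : (n : ℕ) → Set (Matrix (Fin n → Fin d) (Fin n → Fin d) ℂ)) : EReal :=
  ⨆ n : ℕ, ⨆ _ : 1 ≤ n, ⨆ α ∈ Set.Ioi (1 : ℝ), ⨆ σ ∈ S n,
    (((α - 1) / α : ℝ) : EReal) *
      ((r : EReal) - (((n : ℝ)⁻¹ : ℝ) : EReal) * Dsand α (tpow ρ n) σ)

lemma antiDivSup_le_iff {r : ℝ} {x : EReal} : antiDivSup r ρ S ≤ x ↔
    ∀ n : ℕ, 1 ≤ n → ∀ α : ℝ, 1 < α → ∀ y, AttainsLogQ α ρ S n y →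
      (((α - 1) / α * (r - (n : ℝ)⁻¹ * ((α - 1)⁻¹ * y)) : ℝ) : EReal) ≤ x := by
  simp only [antiDivSup, iSup_le_iff, Set.mem_Ioi]
  refine forall_congr' fun n => forall_congr' fun hn => forall_congr' fun α =>
    forall_congr' fun hα => ?_
  constructor
  · rintro h y ⟨σ, hσ, hs, rfl⟩
    have := h σ hσ
    rw [Dsand_of_msupp_le hs] at this
    exact_mod_cast this
  · intro h σ hσ
    by_cases hs : msupp (tpow ρ n) ≤ msupp σ
    · rw [Dsand_of_msupp_le hs]
      exact_mod_cast h _ ⟨σ, hσ, hs, rfl⟩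
    · have h1 : (0 : ℝ) < (n : ℝ)⁻¹ := by positivity
      have h2 : (0 : ℝ) < (α - 1) / α := div_pos (by linarith) (by linarith)
      rw [Dsand_of_not_msupp_le hs hα.le, EReal.coe_mul_top_of_pos h1, EReal.sub_top,
        EReal.coe_mul_bot_of_pos h2]
      exact bot_le

lemma le_antiDivSup {r : ℝ} {n : ℕ} (hn : 1 ≤ n) {α : ℝ} (hα : 1 < α) {y : ℝ}
    (hy : AttainsLogQ α ρ S n y) :
    (((α - 1) / α * (r - (n : ℝ)⁻¹ * ((α - 1)⁻¹ * y)) : ℝ) : EReal) ≤ antiDivSup r ρ S :=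
  antiDivSup_le_iff.mp le_rfl n hn α hα y hy

lemma antiDivSup_nonneg (hρ : IsState ρ)
    (hsupp : ∃ τ ∈ S 1, IsState τ ∧ msupp (tpow ρ 1) ≤ msupp τ) (r : ℝ) :
    0 ≤ antiDivSup r ρ S := by
  obtain ⟨τ, hτ, hτst, hτs⟩ := hsupp
  obtain ⟨C, hC⟩ := exists_log_Qsand_le (tpow_posSemidef hρ.1 1) (rtr_tpow hρ.2 1) hτst.1 hτs
  have hlim : Tendsto (fun α : ℝ => (α - 1) / α * (r - C)) (nhdsWithin 1 (Ioi 1)) (nhds 0) := by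
    have hc : ContinuousAt (fun α : ℝ => (α - 1) / α * (r - C)) 1 :=
      ((by fun_prop : ContinuousAt (fun α : ℝ => α - 1) 1).div continuousAt_id
        one_ne_zero).mul continuousAt_const
    have := hc.tendsto
    simp only [sub_self, zero_div, zero_mul] at this
    exact this.mono_left nhdsWithin_le_nhds
  have hlim' := (continuous_coe_real_ereal.tendsto (0 : ℝ)).comp hlim
  rw [EReal.coe_zero] at hlim'
  refine le_of_tendsto hlim' ?_
  filter_upwards [self_mem_nhdsWithin] with α hα
  have hα' : 1 < α := hα
  refine le_trans ?_ (le_antiDivSup le_rfl hα' ⟨τ, hτ, hτs, rfl⟩)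
  have hp : 0 < α - 1 := by linarith
  rw [Function.comp, EReal.coe_le_coe_iff]
  refine mul_le_mul_of_nonneg_left ?_ (div_nonneg hp.le (by linarith))
  have : (α - 1)⁻¹ * Real.log (Qsand α (tpow ρ 1) τ) ≤ C := by
    rw [inv_mul_le_iff₀ hp]; exact hC α hα'
  simp only [Nat.cast_one, inv_one, one_mul]
  linarith

lemma Hstar_le (hρ : IsState ρ)
    (hsupp : ∃ τ ∈ S 1, IsState τ ∧ msupp (tpow ρ 1) ≤ msupp τ) (r : ℝ) {n : ℕ} (hn : 1 ≤ n)
    {σ : Matrix (Fin n → Fin d) (Fin n → Fin d) ℂ} (hσ : σ ∈ S n) :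
    Hstar (((n * r : ℝ) : EReal)) (tpow ρ n) σ ≤ ((n : ℝ) : EReal) * antiDivSup r ρ S := by
  have hL := antiDivSup_nonneg hρ hsupp r
  have hn' : (0 : ℝ) < n := by exact_mod_cast hn
  have hnL : 0 ≤ ((n : ℝ) : EReal) * antiDivSup r ρ S :=
    mul_nonneg (by exact_mod_cast hn'.le) hL
  by_cases hs : msupp (tpow ρ n) ≤ msupp σ
  · have hterm : ∀ α : ℝ, 1 < α →
        (((α - 1) / α * (n * r - (α - 1)⁻¹ * Real.log (Qsand α (tpow ρ n) σ)) : ℝ) : EReal) ≤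
          ((n : ℝ) : EReal) * antiDivSup r ρ S := by
      intro α hα
      have := mul_le_mul_of_nonneg_left (le_antiDivSup (r := r) hn hα ⟨σ, hσ, hs, rfl⟩)
        (show (0 : EReal) ≤ ((n : ℝ) : EReal) by exact_mod_cast hn'.le)
      refine le_trans (le_of_eq ?_) this
      rw [← EReal.coe_mul]
      congr 1
      field_simp
    refine max_le ?_ ?_
    · simp only [iSup_le_iff, Set.mem_Ici]
      intro α hα
      rcases hα.eq_or_lt with rfl | hα
      · simpa using hnL
      · rw [Dsand_of_msupp_le hs]
        exact_mod_cast hterm α hα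
    · induction hLv : antiDivSup r ρ S with
      | bot => rw [hLv] at hL; exact absurd hL (by simp)
      | top => rw [EReal.coe_mul_top_of_pos hn']; exact le_top
      | coe l =>
        rw [hLv] at hterm
        have hlim : Tendsto (fun α : ℝ => n * r - n * l * (α / (α - 1))) atTop
            (nhds (n * r - n * l * 1)) := by
          refine tendsto_const_nhds.sub (Tendsto.const_mul _ ?_)
          have h1 : Tendsto (fun α : ℝ => 1 + (α - 1)⁻¹) atTop (nhds (1 + 0)) :=
            tendsto_const_nhds.add
              (tendsto_inv_atTop_zero.comp (tendsto_atTop_add_const_right _ (-1) tendsto_id))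
          rw [add_zero] at h1
          refine h1.congr' ?_
          filter_upwards [eventually_gt_atTop 1] with α hα
          have : α - 1 ≠ 0 := by linarith
          field_simp; ring
        have hlim' := ((continuous_coe_real_ereal.tendsto _).comp hlim).limsup_eq
        have hle : (((n * r - n * l * 1 : ℝ)) : EReal) ≤ DsandInf (tpow ρ n) σ := by
          rw [← hlim', DsandInf]
          refine limsup_le_limsup ?_
          filter_upwards [eventually_gt_atTop 1] with α hα
          have hp : 0 < α - 1 := by linarith
          have hα0 : 0 < α := by linarith
          rw [Dsand_of_msupp_le hs, Function.comp, EReal.coe_le_coe_iff]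
          have := hterm α hα
          rw [← EReal.coe_mul, EReal.coe_le_coe_iff, div_mul_eq_mul_div, div_le_iff₀ hα0] at this
          have h2 : n * r - (α - 1)⁻¹ * Real.log (Qsand α (tpow ρ n) σ) ≤ n * l * α / (α - 1) := by
            rw [le_div_iff₀ hp]; linarith
          rw [mul_div_assoc] at h2
          linarith
        calc ((n * r : ℝ) : EReal) - DsandInf (tpow ρ n) σ
            ≤ ((n * r : ℝ) : EReal) - ((n * r - n * l * 1 : ℝ) : EReal) :=
              EReal.sub_le_sub le_rfl hle
          _ = ((n : ℝ) : EReal) * (l : EReal) := by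
              rw [← EReal.coe_sub, ← EReal.coe_mul]; congr 1; ring
  · refine max_le ?_ ?_
    · simp only [iSup_le_iff, Set.mem_Ici]
      intro α hα
      rcases hα.eq_or_lt with rfl | hα
      · simpa using hnL
      · have h2 : (0 : ℝ) < (α - 1) / α := div_pos (by linarith) (by linarith)
        rw [Dsand_of_not_msupp_le hs hα.le, EReal.sub_top, EReal.coe_mul_bot_of_pos h2]
        exact bot_le
    · have : DsandInf (tpow ρ n) σ = ⊤ := by
        have h : (fun α : ℝ => Dsand α (tpow ρ n) σ) =ᶠ[atTop] fun _ => (⊤ : EReal) := by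
          filter_upwards [eventually_ge_atTop 1] with α hα using Dsand_of_not_msupp_le hs hα
        rw [DsandInf, limsup_congr h, limsup_const]
      rw [this, EReal.sub_top]
      exact bot_le

/-- The regularised Hoeffding anti-divergence converges to its supremum. -/
lemma tendsto_Hstar (hρ : IsState ρ) (hS : Assumption1 S)
    (hsupp : ∃ τ ∈ S 1, IsState τ ∧ msupp (tpow ρ 1) ≤ msupp τ) (r : ℝ) :
    Tendsto (fun n : ℕ => (((n : ℝ)⁻¹ : ℝ) : EReal) *
      ⨆ σ ∈ S n, Hstar (((n * r : ℝ) : EReal)) (tpow ρ n) σ) atTop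
      (nhds (antiDivSup r ρ S)) := by
  refine tendsto_order.mpr ⟨fun x hx => ?_, fun x hx => ?_⟩
  · have h1 := antiDivSup_le_iff.not.mp hx.not_ge
    push Not at h1
    obtain ⟨m, hm, α, hα, y, hy, hxy⟩ := h1
    obtain ⟨u, hu, hulim⟩ := exists_attainsLogQ_tendsto hρ hS hsupp hα hm hy
    have hlim : Tendsto (fun n : ℕ => (α - 1) / α * (r - (α - 1)⁻¹ * ((n : ℝ)⁻¹ * u n))) atTop
        (nhds ((α - 1) / α * (r - (α - 1)⁻¹ * ((m : ℝ)⁻¹ * y)))) :=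
      (tendsto_const_nhds.sub (hulim.const_mul _)).const_mul _
    have hlim' := (continuous_coe_real_ereal.tendsto _).comp hlim
    rw [mul_left_comm] at hxy
    filter_upwards [hlim'.eventually (lt_mem_nhds hxy), eventually_ge_atTop 1] with n hnx hn
    refine hnx.trans_le ?_
    have hn' : (0 : ℝ) < n := by exact_mod_cast hn
    obtain ⟨σ, hσ, hs, hlog⟩ := hu n hn
    have hle : (((α - 1) / α : ℝ) : EReal) * (((n * r : ℝ) : EReal) - Dsand α (tpow ρ n) σ) ≤
        ⨆ σ ∈ S n, Hstar (((n * r : ℝ) : EReal)) (tpow ρ n) σ := by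
      refine le_trans ?_ (le_iSup₂ σ hσ)
      refine le_trans ?_ (le_max_left _ _)
      exact le_iSup₂ (f := fun (α : ℝ) (_ : α ∈ Ici 1) => (((α - 1) / α : ℝ) : EReal) *
        (((n * r : ℝ) : EReal) - Dsand α (tpow ρ n) σ)) α hα.le
    refine le_trans (le_of_eq ?_) (mul_le_mul_of_nonneg_left hle
      (show (0 : EReal) ≤ (((n : ℝ)⁻¹ : ℝ) : EReal) by exact_mod_cast (inv_pos.mpr hn').le))
    rw [Dsand_of_msupp_le hs, hlog, Function.comp, ← EReal.coe_sub, ← EReal.coe_mul,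
      ← EReal.coe_mul]
    congr 1
    field_simp
  · filter_upwards [eventually_ge_atTop 1] with n hn
    refine lt_of_le_of_lt ?_ hx
    have hn' : (0 : ℝ) < n := by exact_mod_cast hn
    have := mul_le_mul_of_nonneg_left (iSup₂_le
      (f := fun σ (_ : σ ∈ S n) => Hstar (((n * r : ℝ) : EReal)) (tpow ρ n) σ)
      fun σ hσ => Hstar_le hρ hsupp r hn hσ)
      (show (0 : EReal) ≤ (((n : ℝ)⁻¹ : ℝ) : EReal) by exact_mod_cast (inv_pos.mpr hn').le)
    rwa [← mul_assoc, ← EReal.coe_mul, inv_mul_cancel₀ hn'.ne', EReal.coe_one, one_mul] at this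

lemma bddAbove_rtr_mul {n : ℕ} {X : Set (Matrix (Fin n → Fin d) (Fin n → Fin d) ℂ)}
    (hX : IsCompact X) (T : Matrix (Fin n → Fin d) (Fin n → Fin d) ℂ) :
    BddAbove ((fun σ => rtr (σ * T)) '' X) := by
  refine (hX.image_of_continuousOn (Continuous.continuousOn ?_)).bddAbove
  unfold rtr
  fun_prop

/-- The strong converse bound: no sequence of tests beats the anti-divergence. -/
lemma antiDivSup_le_scExp (hρ : IsState ρ) (hS : Assumption1 S)
    (hsupp : ∃ τ ∈ S 1, IsState τ ∧ msupp (tpow ρ 1) ≤ msupp τ) (r : ℝ) :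
    antiDivSup r ρ S ≤ scExp r ρ S := by
  refine le_iInf fun ⟨T, hT, hTr⟩ => antiDivSup_le_iff.mpr fun m hm α hα y hy => ?_
  dsimp only
  obtain ⟨u, hu, hulim⟩ := exists_attainsLogQ_tendsto hρ hS hsupp hα hm hy
  have hα0 : 0 < α := by linarith
  have hp : 0 < α - 1 := by linarith
  have hβ : 0 < (α - 1) / α := by positivity
  have key : ∀ r' : ℝ, r' < r →
      (((α - 1) / α * (r' - (m : ℝ)⁻¹ * ((α - 1)⁻¹ * y)) : ℝ) : EReal) ≤
        limsup (fun n => rate n (1 - typeI ρ n (T n))) atTop := by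
    intro r' hr'
    have hlim : Tendsto (fun n : ℕ => (α - 1) / α * (r' - (α - 1)⁻¹ * ((n : ℝ)⁻¹ * u n))) atTop
        (nhds ((α - 1) / α * (r' - (α - 1)⁻¹ * ((m : ℝ)⁻¹ * y)))) :=
      (tendsto_const_nhds.sub (hulim.const_mul _)).const_mul _
    have hlim' := ((continuous_coe_real_ereal.tendsto _).comp hlim).limsup_eq
    rw [mul_left_comm (m : ℝ)⁻¹, ← hlim']
    refine limsup_le_limsup ?_
    have hev := eventually_lt_of_lt_liminf
      (lt_of_lt_of_le (EReal.coe_lt_coe_iff.mpr hr') hTr)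
    filter_upwards [hev, eventually_ge_atTop 1] with n hn hn1
    have hn' : (0 : ℝ) < n := by exact_mod_cast hn1
    obtain ⟨σ, hσ, hs, hlog⟩ := hu n hn1
    have hσp := hS.psd n hn1 σ hσ
    have htype : 1 - typeI ρ n (T n) = rtr (T n * tpow ρ n) := by
      have h1 := rtr_tpow hρ.2 n
      simp only [typeI, rtr, sub_mul, one_mul, Matrix.trace_sub, Complex.sub_re] at h1 ⊢
      rw [h1]; ring
    have h1 := rtr_test_le (tpow_posSemidef hρ.1 n) hσp hs (hT n) hα
    have h2 : rtr (σ * T n) ≤ Real.exp (-(n * r')) :=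
      (le_csSup (bddAbove_rtr_mul (hS.compact n hn1) (T n)) ⟨σ, hσ, rfl⟩).trans
        (le_exp_of_lt_rate hn1 hn)
    have hQ := Qsand_pos (tpow_posSemidef hρ.1 n) (rtr_tpow hρ.2 n) hσp hs hα
    refine le_rate_of_le_exp hn1 ?_
    rw [htype]
    refine h1.trans ?_
    have h3 := Real.rpow_le_rpow (rtr_mul_nonneg hσp (hT n).1) h2 hβ.le
    refine (mul_le_mul_of_nonneg_left h3 (Real.rpow_nonneg hQ.le _)).trans (le_of_eq ?_)
    rw [← Real.exp_mul, Real.rpow_def_of_pos hQ, hlog, ← Real.exp_add]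
    congr 1
    field_simp
    ring
  have hc : Tendsto (fun r' : ℝ =>
      (((α - 1) / α * (r' - (m : ℝ)⁻¹ * ((α - 1)⁻¹ * y)) : ℝ) : EReal)) (nhdsWithin r (Iio r))
      (nhds (((α - 1) / α * (r - (m : ℝ)⁻¹ * ((α - 1)⁻¹ * y)) : ℝ) : EReal)) := by
    refine Tendsto.mono_left ?_ nhdsWithin_le_nhds
    exact (continuous_coe_real_ereal.comp (by fun_prop : Continuous fun r' : ℝ =>
      (α - 1) / α * (r' - (m : ℝ)⁻¹ * ((α - 1)⁻¹ * y)))).tendsto r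
  refine le_of_tendsto hc ?_
  filter_upwards [self_mem_nhdsWithin] with r' hr' using key r' hr'

end Family

lemma rtr_smul (c : ℝ) (A : Matrix ι ι ℂ) : rtr (c • A) = c * rtr A := by
  simp [rtr, Matrix.trace_smul]

lemma rtr_sum {κ : Type*} (s : Finset κ) (A : κ → Matrix ι ι ℂ) :
    rtr (∑ i ∈ s, A i) = ∑ i ∈ s, rtr (A i) := by
  simp [rtr, Matrix.trace_sum]

lemma posSemidef_real_smul {c : ℝ} (hc : 0 ≤ c) {A : Matrix ι ι ℂ} (hA : A.PosSemidef) :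
    (c • A).PosSemidef := by
  have : c • A = (c : ℂ) • A := by ext; simp
  rw [this]
  exact hA.smul (by exact_mod_cast hc)

/-- Post-processing a resolution of the identity by weights in `[0, 1]` gives a test. -/
lemma isTest_sum_smul {κ : Type*} [Fintype κ] {G : κ → Matrix ι ι ℂ}
    (hG : ∀ x, (G x).PosSemidef) (hG1 : ∑ x, G x = 1) {f : κ → ℝ} (hf : ∀ x, 0 ≤ f x)
    (hf1 : ∀ x, f x ≤ 1) : IsTest (∑ x, f x • G x) := by
  refine ⟨Matrix.posSemidef_sum _ fun x _ => posSemidef_real_smul (hf x) (hG x), ?_⟩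
  have : 1 - ∑ x, f x • G x = ∑ x, (1 - f x) • G x := by
    simp only [sub_smul, one_smul, Finset.sum_sub_distrib, hG1]
  rw [this]
  exact Matrix.posSemidef_sum _ fun x _ => posSemidef_real_smul (by linarith [hf1 x]) (hG x)

lemma IsPOVM.isTest {k : ℕ} {M : Fin k → Matrix ι ι ℂ} (hM : IsPOVM M) (i : Fin k) :
    IsTest (M i) := by
  have := isTest_sum_smul hM.1 hM.2 (f := fun j => if j = i then 1 else 0)
    (fun j => by positivity) (fun j => by split_ifs <;> norm_num)
  simpa using this

section Family

variable {d : ℕ} {ρ : Matrix (Fin d) (Fin d) ℂ}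
  {S : (n : ℕ) → Set (Matrix (Fin n → Fin d) (Fin n → Fin d) ℂ)}

/-- There is a measurement on `n` systems which reproduces on `ρ^{⊗n}` the `N`-fold product
distribution of `p`, and whose `w`-weighted sum is, up to the factor `C`, in the polar. -/
def HasProductMeasurement (ρ : Matrix (Fin d) (Fin d) ℂ)
    (S : (n : ℕ) → Set (Matrix (Fin n → Fin d) (Fin n → Fin d) ℂ)) {k : ℕ} (p w : Fin k → ℝ)
    (C : ℝ) (n N : ℕ) : Prop :=
  ∃ G : (Fin N → Fin k) → Matrix (Fin n → Fin d) (Fin n → Fin d) ℂ,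
    (∀ x, (G x).PosSemidef) ∧ ∑ x, G x = 1 ∧ (∀ x, rtr (G x * tpow ρ n) = ∏ i, p (x i)) ∧
    C • ∑ x, (∏ i, w (x i)) • G x ∈ polar (S n)

lemma HasProductMeasurement.zero (hρ : IsState ρ) {k : ℕ} (p w : Fin k → ℝ) {C : ℝ} {n : ℕ}
    (hC : C • (1 : Matrix (Fin n → Fin d) (Fin n → Fin d) ℂ) ∈ polar (S n)) :
    HasProductMeasurement ρ S p w C n 0 :=
  ⟨fun _ => 1, fun _ => Matrix.PosSemidef.one, by simp, by simp [rtr_tpow hρ.2], by simpa using hC⟩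

lemma HasProductMeasurement.succ (hρ : IsState ρ) (hS : Assumption1 S) {k m n N : ℕ}
    (hm : 1 ≤ m) (hn : 1 ≤ n) {M : Fin k → Matrix (Fin m → Fin d) (Fin m → Fin d) ℂ}
    (hM : IsPOVM M) {w : Fin k → ℝ} (hw : ∑ i, w i • M i ∈ polar (S m)) {C : ℝ}
    (h : HasProductMeasurement ρ S (fun i => rtr (M i * tpow ρ m)) w C n N) :
    HasProductMeasurement ρ S (fun i => rtr (M i * tpow ρ m)) w C (n + m) (N + 1) := by
  obtain ⟨G, hG, hG1, hGp, hGw⟩ := h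
  refine ⟨fun x => tensOp (G (Fin.tail x)) (M (x 0)), fun x => tensOp_posSemidef (hG _) (hM.1 _),
    ?_, fun x => ?_, ?_⟩
  · rw [sum_prod_cons, Finset.sum_comm]
    simp only [Fin.tail_cons, Fin.cons_zero]
    rw [← tensOp_sum_sum, hG1, hM.2, tensOp_one]
  · rw [tpow_add, tensOp_mul, rtr_tensOp (trace_mul_im_eq_zero (hG _).1
      (tpow_posSemidef hρ.1 n).1), hGp, Fin.prod_univ_succ, mul_comm]
    rfl
  · have := hS.polarTens n m hn hm _ hGw _ hw
    convert this using 1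
    rw [sum_prod_cons, Finset.sum_comm]
    simp only [Fin.prod_univ_succ, Fin.tail_cons, Fin.cons_zero, Fin.cons_succ]
    rw [← one_smul ℝ (∑ i, w i • M i), tensOp_smul_smul, tensOp_sum_sum, mul_one]
    simp only [tensOp_smul_smul, mul_comm]

/-- The test obtained from a product measurement by thresholding the weighted likelihood. -/
lemma HasProductMeasurement.exists_test (hρ : IsState ρ) (hS : Assumption1 S) {k n N : ℕ}
    (hn : 1 ≤ n) (hne : (S n).Nonempty) {p w : Fin k → ℝ} (hw : ∀ i, 0 ≤ w i) {C : ℝ}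
    (hC : 0 < C) (h : HasProductMeasurement ρ S p w C n N) (b : ℝ) :
    ∃ T, IsTest T ∧ typeII (S n) T ≤ Real.exp (-b) / C ∧
      1 - typeI ρ n T =
        ∑ x : Fin N → Fin k, min 1 (Real.exp (-b) * ∏ i, w (x i)) * ∏ i, p (x i) := by
  obtain ⟨G, hG, hG1, hGp, hGw⟩ := h
  set f : (Fin N → Fin k) → ℝ := fun x => min 1 (Real.exp (-b) * ∏ i, w (x i)) with hf
  have hf0 : ∀ x, 0 ≤ f x := fun x => le_min zero_le_one
    (mul_nonneg (Real.exp_pos _).le (Finset.prod_nonneg fun i _ => hw _))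
  refine ⟨∑ x, f x • G x, isTest_sum_smul hG hG1 hf0 fun x => min_le_left _ _, ?_, ?_⟩
  · refine csSup_le (hne.image _) ?_
    rintro _ ⟨σ, hσ, rfl⟩
    have hσp := hS.psd n hn σ hσ
    have h1 := hGw.2 σ hσ
    rw [smul_mul_assoc, rtr_smul, Finset.sum_mul, rtr_sum] at h1
    simp only [smul_mul_assoc, rtr_smul] at h1
    dsimp only
    rw [rtr_mul_comm, Finset.sum_mul, rtr_sum]
    simp only [smul_mul_assoc, rtr_smul]
    calc ∑ x, f x * rtr (G x * σ)
        ≤ ∑ x, Real.exp (-b) * ((∏ i, w (x i)) * rtr (G x * σ)) := by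
          refine Finset.sum_le_sum fun x _ => ?_
          rw [← mul_assoc]
          exact mul_le_mul_of_nonneg_right (min_le_right _ _) (rtr_mul_nonneg (hG x) hσp)
      _ = Real.exp (-b) * ∑ x, (∏ i, w (x i)) * rtr (G x * σ) := by rw [Finset.mul_sum]
      _ ≤ Real.exp (-b) * (1 / C) := by
          refine mul_le_mul_of_nonneg_left ?_ (Real.exp_pos _).le
          rw [le_div_iff₀ hC, mul_comm]; exact h1
      _ = Real.exp (-b) / C := by ring
  · have h1 := rtr_tpow hρ.2 n
    have h2 : 1 - typeI ρ n (∑ x, f x • G x) = rtr ((∑ x, f x • G x) * tpow ρ n) := by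
      simp only [typeI, rtr, sub_mul, one_mul, Matrix.trace_sub, Complex.sub_re] at h1 ⊢
      rw [h1]; ring
    rw [h2, Finset.sum_mul, rtr_sum]
    simp only [smul_mul_assoc, rtr_smul, hGp, hf]

lemma exists_smul_one_mem_polar (hS : Assumption1 S) (m : ℕ) :
    ∃ C : ℝ, 0 < C ∧ ∀ s, 1 ≤ s → s ≤ m →
      C • (1 : Matrix (Fin s → Fin d) (Fin s → Fin d) ℂ) ∈ polar (S s) := by
  have hB : ∀ s : ℕ, ∃ B : ℝ, 1 ≤ s → ∀ σ ∈ S s, rtr σ ≤ B := by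
    intro s
    by_cases hs : 1 ≤ s
    · obtain ⟨B, hB⟩ := bddAbove_rtr_mul (hS.compact s hs) 1
      refine ⟨B, fun _ σ hσ => ?_⟩
      have := hB ⟨σ, hσ, rfl⟩
      simpa using this
    · exact ⟨0, fun h => absurd h hs⟩
  choose B hB using hB
  have hsum : 0 ≤ ∑ s ∈ Finset.range (m + 1), |B s| := Finset.sum_nonneg fun _ _ => abs_nonneg _
  have hpos : 0 < 1 + ∑ s ∈ Finset.range (m + 1), |B s| := by linarith
  refine ⟨(1 + ∑ s ∈ Finset.range (m + 1), |B s|)⁻¹, inv_pos.mpr hpos, fun s hs hsm =>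
    ⟨posSemidef_real_smul (inv_pos.mpr hpos).le Matrix.PosSemidef.one, fun σ hσ => ?_⟩⟩
  rw [smul_mul_assoc, one_mul, rtr_smul, inv_mul_le_iff₀ hpos, mul_one]
  have h1 := hB s hs σ hσ
  have h2 := Finset.single_le_sum (f := fun s => |B s|) (fun i _ => abs_nonneg (B i))
    (Finset.mem_range.mpr (Nat.lt_succ_of_le hsm))
  have := le_abs_self (B s)
  linarith

lemma HasProductMeasurement.add_mul (hρ : IsState ρ) (hS : Assumption1 S) {k m s : ℕ}
    (hm : 1 ≤ m) (hs : 1 ≤ s) {M : Fin k → Matrix (Fin m → Fin d) (Fin m → Fin d) ℂ}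
    (hM : IsPOVM M) {w : Fin k → ℝ} (hw : ∑ i, w i • M i ∈ polar (S m)) {C : ℝ}
    (hC : C • (1 : Matrix (Fin s → Fin d) (Fin s → Fin d) ℂ) ∈ polar (S s)) (N : ℕ) :
    HasProductMeasurement ρ S (fun i => rtr (M i * tpow ρ m)) w C (s + N * m) N := by
  induction N with
  | zero => simpa using HasProductMeasurement.zero hρ _ w hC
  | succ N ih =>
    have := ih.succ hρ hS hm (by omega) hM hw
    convert this using 1
    ring

/-- If a fixed measurement on `m` systems has all its classical anti-divergence terms bounded
by `R`, then it yields a sequence of tests with strong converse rate at most `R`. -/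
lemma scExp_le_of_isPOVM (hρ : IsState ρ) (hS : Assumption1 S)
    (hsupp : ∃ τ ∈ S 1, IsState τ ∧ msupp (tpow ρ 1) ≤ msupp τ) (r : ℝ) {m k : ℕ} (hm : 1 ≤ m)
    {M : Fin k → Matrix (Fin m → Fin d) (Fin m → Fin d) ℂ} (hM : IsPOVM M) {R : ℝ}
    (hR : ∀ α : ℝ, 1 < α → ∀ σ ∈ S m, (α - 1) / α * (r - (m : ℝ)⁻¹ *
      classRenyi α (fun i => rtr (M i * tpow ρ m)) (fun i => rtr (M i * σ))) ≤ R) :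
    scExp r ρ S ≤ (R : EReal) := by
  have hm' : (0 : ℝ) < m := by exact_mod_cast hm
  have hatt : ∀ n, 1 ≤ n → ∃ σ ∈ S n, msupp (tpow ρ n) ≤ msupp σ := by
    intro n hn
    obtain ⟨τ, hτ, -, hτs⟩ := hsupp
    have h1 : AttainsLogQ 2 ρ S 1 _ := ⟨τ, hτ, hτs, rfl⟩
    obtain ⟨σ, hσ, hs, -⟩ := h1.nsmul hρ hS one_lt_two hn
    exact ⟨σ, hσ, hs⟩
  obtain ⟨σ₀, hσ₀, hσ₀s⟩ := hatt m hm
  have hρm := tpow_posSemidef hρ.1 m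
  set p : Fin k → ℝ := fun i => rtr (M i * tpow ρ m) with hp
  set Φ : Matrix (Fin m → Fin d) (Fin m → Fin d) ℂ → Fin k → ℝ := fun σ i => rtr (M i * σ) with hΦ
  have hΦadd : ∀ (a b : ℝ) σ τ, Φ (a • σ + b • τ) = a • Φ σ + b • Φ τ := by
    intro a b σ τ
    ext i
    simp [hΦ, rtr, mul_add, Matrix.trace_add, Matrix.trace_smul]
  have hΦc : Continuous Φ := by
    refine continuous_pi fun i => ?_
    simp only [hΦ, rtr]
    fun_prop
  have hQconv : Convex ℝ (Φ '' S m) := by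
    rintro _ ⟨σ, hσ, rfl⟩ _ ⟨τ, hτ, rfl⟩ a b ha hb hab
    exact ⟨a • σ + b • τ, hS.convex m hm hσ hτ ha hb hab, hΦadd a b σ τ⟩
  have hp1 : ∑ i, p i = 1 := by
    rw [hp, ← rtr_sum, ← Finset.sum_mul, hM.2, one_mul, rtr_tpow hρ.2]
  obtain ⟨t, w, ht0, hw0, ht1, htp, htw, hwQ, hE⟩ := exists_distribution_weight
    (p := p) (fun i => rtr_mul_nonneg (hM.1 i) hρm) hp1 hQconv
    ((hS.compact m hm).image hΦc)
    (by rintro _ ⟨σ, hσ, rfl⟩ i; exact rtr_mul_nonneg (hM.1 i) (hS.psd m hm σ hσ))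
    ⟨σ₀, hσ₀, rfl⟩
    (by
      intro i hi
      have hσ₀p := hS.psd m hm σ₀ hσ₀
      refine (rtr_mul_nonneg (hM.1 i) hσ₀p).lt_of_ne fun h0 => ?_
      have := rtr_test_le hρm hσ₀p hσ₀s (hM.isTest i) one_lt_two
      rw [rtr_mul_comm σ₀, ← h0, Real.zero_rpow (by norm_num), mul_zero] at this
      exact absurd hi this.not_gt)
    (m * r) (m * R)
    (by
      rintro s hs0 hs1 _ ⟨σ, hσ, rfl⟩ -
      have h1s : 0 < 1 - s := by linarith
      have hα : 1 < 1 / (1 - s) := by rw [lt_div_iff₀ h1s]; linarith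
      have h1 := mul_le_mul_of_nonneg_left (hR _ hα σ hσ) hm'.le
      rw [classRenyi] at h1
      refine le_trans (le_of_eq ?_) h1
      have e1 : (1 / (1 - s) - 1) = s / (1 - s) := by field_simp; ring
      have e2 : (1 / (1 - s) - 1) / (1 / (1 - s)) = s := by rw [e1]; field_simp
      rw [e2, e1]
      simp only [hΦ]
      field_simp)
  obtain ⟨K, hK⟩ := exists_exp_le_sum_min (fun i => rtr_mul_nonneg (hM.1 i) hρm) ht0 hw0 ht1
    htp htw (m * r)
  have hW : ∑ i, w i • M i ∈ polar (S m) := by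
    refine ⟨Matrix.posSemidef_sum _ fun i _ => posSemidef_real_smul (hw0 i) (hM.1 i),
      fun σ hσ => ?_⟩
    rw [Finset.sum_mul, rtr_sum]
    simp only [smul_mul_assoc, rtr_smul]
    exact hwQ _ ⟨σ, hσ, rfl⟩
  obtain ⟨C, hC, hCS⟩ := exists_smul_one_mem_polar hS m
  have key : ∀ n : ℕ, ∃ (T : Matrix (Fin n → Fin d) (Fin n → Fin d) ℂ) (N s : ℕ), IsTest T ∧
      (1 ≤ n → n = s + N * m ∧ s ≤ m ∧
        typeII (S n) T ≤ Real.exp (-(N * (m * r))) / C ∧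
        Real.exp (-(N * (m * R)) - K * √N) ≤ 1 - typeI ρ n T) := by
    intro n
    by_cases hn : 1 ≤ n
    · obtain ⟨s, N, hnN, hs1, hsm⟩ := exists_eq_add_mul hm hn
      have hG := HasProductMeasurement.add_mul hρ hS hm hs1 hM hW (hCS s hs1 hsm) N
      rw [← hnN] at hG
      obtain ⟨σ, hσ, -⟩ := hatt n hn
      obtain ⟨T, hT, hT2, hT1⟩ := hG.exists_test hρ hS hn ⟨σ, hσ⟩ hw0 hC (N * (m * r))
      refine ⟨T, N, s, hT, fun _ => ⟨hnN, hsm, hT2, ?_⟩⟩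
      rw [hT1]
      refine le_trans (Real.exp_le_exp.mpr ?_) (hK N)
      have := mul_le_mul_of_nonneg_left hE (Nat.cast_nonneg (α := ℝ) N)
      linarith
    · exact ⟨1, 0, 0, isTest_one, fun h => absurd h hn⟩
  choose T N s hT hN using key
  have hNr : ∀ x c : ℝ, ∀ n : ℕ, 1 ≤ n → |(N n * (m * x) + c) - n * x| ≤ m * |x| + |c| := by
    intro x c n hn
    obtain ⟨h1, h2, -, -⟩ := hN n hn
    have h3 : (n : ℝ) = s n + N n * m := by exact_mod_cast h1
    have h4 : (s n : ℝ) ≤ m := by exact_mod_cast h2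
    have e : (N n * (m * x) + c) - n * x = -(s n * x) + c := by rw [h3]; ring
    rw [e]
    refine (abs_add_le _ _).trans ?_
    rw [abs_neg, abs_mul, Nat.abs_cast]
    linarith [mul_le_mul_of_nonneg_right h4 (abs_nonneg x)]
  have hII : (r : EReal) ≤ liminf (fun n => rate n (typeII (S n) (T n))) atTop := by
    have hlim := ((continuous_coe_real_ereal.tendsto _).comp
      (tendsto_inv_mul_of_abs_sub_le (hNr r (Real.log C)))).liminf_eq
    rw [← hlim]
    refine liminf_le_liminf ?_
    filter_upwards [eventually_ge_atTop 1] with n hn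
    have hn' : (n : ℝ) ≠ 0 := by positivity
    refine le_rate_of_le_exp hn ((hN n hn).2.2.1.trans (le_of_eq ?_))
    rw [mul_inv_cancel_left₀ hn', neg_add, Real.exp_add, Real.exp_neg (Real.log C),
      Real.exp_log hC, div_eq_mul_inv]
  refine (iInf_le _ (⟨T, hT, hII⟩ : {T : (n : ℕ) → Matrix (Fin n → Fin d) (Fin n → Fin d) ℂ //
      (∀ n, IsTest (T n)) ∧
      (r : EReal) ≤ Filter.liminf (fun n => rate n (typeII (S n) (T n))) Filter.atTop})).trans ?_
  dsimp only
  have hsq : Tendsto (fun n : ℕ => |K| * (√(n : ℝ))⁻¹) atTop (nhds (|K| * 0)) :=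
    (tendsto_inv_atTop_zero.comp
      (Real.tendsto_sqrt_atTop.comp tendsto_natCast_atTop_atTop)).const_mul _
  have hlim := (continuous_coe_real_ereal.tendsto _).comp
    ((tendsto_inv_mul_of_abs_sub_le (hNr R 0)).add hsq)
  rw [mul_zero, add_zero] at hlim
  rw [← hlim.limsup_eq]
  refine limsup_le_limsup ?_
  filter_upwards [eventually_ge_atTop 1] with n hn
  have hn' : (0 : ℝ) < n := by exact_mod_cast hn
  obtain ⟨h1, -, -, h4⟩ := hN n hn
  refine rate_le_of_exp_le hn (le_trans (Real.exp_le_exp.mpr ?_) h4)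
  have hNn : (N n : ℝ) ≤ n := by
    have : N n ≤ N n * m := Nat.le_mul_of_pos_right _ hm
    exact_mod_cast (show N n ≤ n by omega)
  have h5 : K * √(N n : ℝ) ≤ |K| * √(n : ℝ) :=
    mul_le_mul (le_abs_self K) (Real.sqrt_le_sqrt hNn) (Real.sqrt_nonneg _) (abs_nonneg K)
  have h6 : (n : ℝ) * (√(n : ℝ))⁻¹ = √(n : ℝ) := by
    rw [← div_eq_mul_inv, Real.div_sqrt]
  have e : (n : ℝ) * ((n : ℝ)⁻¹ * (N n * (m * R) + 0) + |K| * (√(n : ℝ))⁻¹) =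
      N n * (m * R) + |K| * √(n : ℝ) := by
    rw [mul_add, mul_inv_cancel_left₀ hn'.ne', mul_left_comm (n : ℝ) |K|, h6, add_zero]
  rw [e]
  linarith

end Family

/-- Proposition 35 of the paper: bounds on the strong converse exponent
of generalized quantum hypothesis testing. -/
theorem strong_converse_exponent_bounds {d : ℕ}
    (ρ : Matrix (Fin d) (Fin d) ℂ) (hρ : IsState ρ)
    (S : (n : ℕ) → Set (Matrix (Fin n → Fin d) (Fin n → Fin d) ℂ))
    (hS : Assumption1 S)
    (hsupp : ∃ τ ∈ S 1, IsState τ ∧ msupp (tpow ρ 1) ≤ msupp τ)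
    (r : ℝ) (hr : 0 < r) :
    ∃ L : EReal,
      Filter.Tendsto
        (fun n : ℕ => (((n : ℝ)⁻¹ : ℝ) : EReal) *
          ⨆ σ ∈ S n, Hstar (((n * r : ℝ) : EReal)) (tpow ρ n) σ)
        Filter.atTop (nhds L) ∧
      L = (⨆ n : ℕ, ⨆ _ : 1 ≤ n, ⨆ α ∈ Set.Ioi (1 : ℝ), ⨆ σ ∈ S n,
        (((α - 1) / α : ℝ) : EReal) *
          ((r : EReal) - (((n : ℝ)⁻¹ : ℝ) : EReal) * Dsand α (tpow ρ n) σ)) ∧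
      L ≤ scExp r ρ S ∧
      scExp r ρ S ≤ ⨅ n : ℕ, ⨅ _ : 1 ≤ n, ⨅ k : ℕ,
        ⨅ M : {M : Fin k → Matrix (Fin n → Fin d) (Fin n → Fin d) ℂ // IsPOVM M},
          ⨆ α ∈ Set.Ioi (1 : ℝ), ⨆ σ ∈ S n,
            (((α - 1) / α : ℝ) : EReal) *
              ((r : EReal) - (((n : ℝ)⁻¹ : ℝ) : EReal) *
                ((classRenyi α (fun i => rtr (M.1 i * tpow ρ n))
                  (fun i => rtr (M.1 i * σ)) : ℝ) : EReal)) := by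
  refine ⟨antiDivSup r ρ S, tendsto_Hstar hρ hS hsupp r, rfl, antiDivSup_le_scExp hρ hS hsupp r,
    le_iInf fun n => le_iInf fun hn => le_iInf fun k => le_iInf fun M => ?_⟩
  obtain ⟨τ, hτ, hτst, hτs⟩ := hsupp
  have hτ1 : AttainsLogQ 2 ρ S 1 _ := ⟨τ, hτ, hτs, rfl⟩
  obtain ⟨σ₀, hσ₀, -, -⟩ := hτ1.nsmul hρ hS one_lt_two hn
  set V : EReal := ⨆ α ∈ Set.Ioi (1 : ℝ), ⨆ σ ∈ S n,
    (((α - 1) / α : ℝ) : EReal) *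
      ((r : EReal) - (((n : ℝ)⁻¹ : ℝ) : EReal) *
        ((classRenyi α (fun i => rtr (M.1 i * tpow ρ n))
          (fun i => rtr (M.1 i * σ)) : ℝ) : EReal)) with hV
  have hle : ∀ α : ℝ, 1 < α → ∀ σ ∈ S n, (((α - 1) / α * (r - (n : ℝ)⁻¹ *
      classRenyi α (fun i => rtr (M.1 i * tpow ρ n)) (fun i => rtr (M.1 i * σ))) : ℝ) : EReal)
        ≤ V := by
    intro α hα σ hσ
    have h : V ≤ V := le_rfl
    nth_rewrite 1 [hV] at h
    simp only [iSup_le_iff] at h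
    exact_mod_cast h α hα σ hσ
  clear_value V
  induction V with
  | bot => exact absurd (hle 2 one_lt_two σ₀ hσ₀) (EReal.bot_lt_coe _).not_ge
  | top => exact le_top
  | coe R =>
    exact scExp_le_of_isPOVM hρ hS ⟨τ, hτ, hτst, hτs⟩ r hn M.2 fun α hα σ hσ =>
      EReal.coe_le_coe_iff.mp (hle α hα σ hσ)

end QHT
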